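/- arXiv:1207.2385 — 3 statements merged into one kernel-verified Lean document; each statement's English description precedes it below -/
import Mathlib

section
/- Let 𝔬 be the ring of integers of a number field and 𝔞, 𝔟, 𝔠 nonzero integral ideals with 𝔞 = 𝔟𝔠. Suppose α ∈ 𝔬 satisfies ord_𝔭(α) = ord_𝔭(𝔟) for all primes 𝔭 dividing 𝔞. Then every residue class in 𝔬/𝔞 can be represented as β + μα with β running over a set of representatives of 𝔬/𝔟 and μ over a set of representatives of 𝔬/𝔠. -/
open NumberField

/-- Let `𝔞 = 𝔟𝔠` be nonzero integral ideals of the ring of integers of a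
number field, and let `α` satisfy `ord_𝔭(α) = ord_𝔭(𝔟)` for all primes `𝔭 ∣ 𝔞`. Then for any
sets `Sβ`, `Sμ` of representatives of `𝔬/𝔟` and `𝔬/𝔠` respectively, every residue class
mod `𝔞` is represented as `β + μ·α` with `β ∈ Sβ` and `μ ∈ Sμ`. -/
theorem stmt3 (K : Type*) [Field K] [NumberField K]
    (𝔞 𝔟 𝔠 : Ideal (𝓞 K)) (h𝔞 : 𝔞 ≠ ⊥) (h𝔟 : 𝔟 ≠ ⊥) (h𝔠 : 𝔠 ≠ ⊥)
    (hprod : 𝔞 = 𝔟 * 𝔠) (α : 𝓞 K)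
    (hα : ∀ 𝔭 : Ideal (𝓞 K), 𝔭.IsPrime → 𝔭 ≠ ⊥ → 𝔭 ∣ 𝔞 →
      emultiplicity 𝔭 (Ideal.span {α}) = emultiplicity 𝔭 𝔟)
    (Sβ Sμ : Set (𝓞 K))
    (hSβ : ∀ y : 𝓞 K ⧸ 𝔟, ∃! b, b ∈ Sβ ∧ Ideal.Quotient.mk 𝔟 b = y)
    (hSμ : ∀ y : 𝓞 K ⧸ 𝔠, ∃! m, m ∈ Sμ ∧ Ideal.Quotient.mk 𝔠 m = y) :
    ∀ x : 𝓞 K ⧸ 𝔞, ∃ β ∈ Sβ, ∃ μ ∈ Sμ, Ideal.Quotient.mk 𝔞 (β + μ * α) = x := by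
  classical
  have fin : ∀ (p I : Ideal (𝓞 K)), p.IsPrime → I ≠ ⊥ → FiniteMultiplicity p I := by
    intro p I hp hI
    exact FiniteMultiplicity.of_not_isUnit (fun h => hp.ne_top (Ideal.isUnit_iff.mp h)) hI
  have key : ∀ (g p d e : Ideal (𝓞 K)), p.IsPrime → p ≠ ⊥ → g ≠ ⊥ → p ∣ e → ¬ p ∣ d →
      emultiplicity p (g * d) = emultiplicity p (g * e) → False := by
    intro g p d e hp hp0 hg hpe hpd h
    have hpp : Prime p := Ideal.prime_of_isPrime hp0 hp
    rw [emultiplicity_mul hpp, emultiplicity_mul hpp] at h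
    have hf : emultiplicity p g ≠ ⊤ := finiteMultiplicity_iff_emultiplicity_ne_top.mp (fin p g hp hg)
    have h2 := ENat.add_right_injective_of_ne_top hf h
    rw [emultiplicity_eq_zero.mpr hpd] at h2
    exact emultiplicity_eq_zero.mp h2.symm hpe
  have hba : 𝔟 ∣ Ideal.span {α} := by
    set g := 𝔟 ⊔ Ideal.span {α} with hgdef
    have hg : g ≠ ⊥ := fun h => h𝔟 (le_bot_iff.mp (h ▸ le_sup_left))
    obtain ⟨e, he⟩ : g ∣ 𝔟 := Ideal.dvd_iff_le.mpr le_sup_left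
    obtain ⟨d, hd⟩ : g ∣ Ideal.span {α} := Ideal.dvd_iff_le.mpr le_sup_right
    have hed : e ⊔ d = ⊤ := by
      have h1 : g * (e ⊔ d) = g * ⊤ := by
        rw [Ideal.mul_sup, ← he, ← hd, Ideal.mul_top]
      exact mul_left_cancel₀ hg h1
    by_cases het : e = ⊤
    · rw [het, Ideal.mul_top] at he
      exact ⟨d, by rw [he]; exact hd⟩
    · exfalso
      obtain ⟨p, hpm, hpe⟩ := Ideal.exists_le_maximal e het
      have hp0 : p ≠ ⊥ := by
        rintro rfl
        rw [le_bot_iff.mp hpe] at he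
        exact h𝔟 (by rw [he, Ideal.mul_bot])
      have hpd : ¬ p ∣ d := fun h => hpm.ne_top
        (top_le_iff.mp (hed ▸ sup_le hpe (Ideal.dvd_iff_le.mp h)))
      have hpe' : p ∣ e := Ideal.dvd_iff_le.mpr hpe
      have hpb : p ∣ 𝔟 := he ▸ Dvd.dvd.mul_left hpe' g
      have h := hα p hpm.isPrime hp0 (hprod ▸ Dvd.dvd.mul_right hpb 𝔠)
      refine key g p d e hpm.isPrime hp0 hg hpe' hpd ?_
      rw [← hd, ← he]; exact h
  obtain ⟨d, hd⟩ := hba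
  have hcop : 𝔠 ⊔ d = ⊤ := by
    by_contra hne
    obtain ⟨p, hpm, hple⟩ := Ideal.exists_le_maximal _ hne
    have hpc : p ∣ 𝔠 := Ideal.dvd_iff_le.mpr (le_sup_left.trans hple)
    have hpd : p ∣ d := Ideal.dvd_iff_le.mpr (le_sup_right.trans hple)
    have hp0 : p ≠ ⊥ := by
      rintro rfl
      exact h𝔠 (le_bot_iff.mp (le_sup_left.trans hple))
    have h := hα p hpm.isPrime hp0 (hprod ▸ Dvd.dvd.mul_left hpc 𝔟)
    refine key 𝔟 p ⊤ d hpm.isPrime hp0 h𝔟 hpd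
      (fun h => hpm.ne_top (top_le_iff.mp (Ideal.dvd_iff_le.mp h))) ?_
    rw [← hd, Ideal.mul_top]; exact h.symm
  have hsup : 𝔞 ⊔ Ideal.span {α} = 𝔟 := by
    rw [hprod, hd, ← Ideal.mul_sup, hcop, Ideal.mul_top]
  intro x
  obtain ⟨x, rfl⟩ := Ideal.Quotient.mk_surjective x
  obtain ⟨β, ⟨hβ, hβx⟩, -⟩ := hSβ (Ideal.Quotient.mk 𝔟 x)
  have hmem : x - β ∈ 𝔞 ⊔ Ideal.span {α} := by
    rw [hsup]; exact Ideal.Quotient.eq.mp hβx.symm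
  obtain ⟨a, ha, y, hy, hay⟩ := Submodule.mem_sup.mp hmem
  obtain ⟨ν, rfl⟩ := Ideal.mem_span_singleton'.mp hy
  obtain ⟨μ, ⟨hμ, hμν⟩, -⟩ := hSμ (Ideal.Quotient.mk 𝔠 ν)
  refine ⟨β, hβ, μ, hμ, Ideal.Quotient.eq.mpr ?_⟩
  have hαb : α ∈ 𝔟 := hsup ▸ (le_sup_right : Ideal.span {α} ≤ 𝔞 ⊔ Ideal.span {α})
    (Ideal.mem_span_singleton_self α)
  have h1 : α * (μ - ν) ∈ 𝔞 := by
    rw [hprod]; exact Ideal.mul_mem_mul hαb (Ideal.Quotient.eq.mp hμν)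
  have h2 : β + μ * α - x = α * (μ - ν) - a := by linear_combination hay
  rw [h2]
  exact sub_mem h1 ha
end

section
/- Let 𝔬 be the ring of integers of a number field, ε > 0, and 𝔟 a nonzero integral ideal. Then there exists α ∈ 𝔟 and a prime ideal 𝔭 coprime to 𝔟 which is unramified, with N𝔭 ≪_ε (N𝔟)^ε, such that (α) = 𝔟𝔭. In particular, |N_{K/ℚ}(α)| ≪_ε (N𝔟)^{1+ε}. -/
section stmtE1
open FourierTransform ContDiff MeasureTheory
lemma stmtE_iter_cs {g : ℝ → ℂ} (hg' : HasCompactSupport g) (j : ℕ) :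
    HasCompactSupport (iteratedDeriv j g) := by
  induction j with
  | zero => simpa using hg'
  | succ j ih => rw [iteratedDeriv_succ]; exact ih.deriv

lemma stmtE_poisson1 (k : ℕ) (hk : 2 ≤ k) : ∃ C : ℝ, 0 ≤ C ∧ ∀ g : ℝ → ℂ, ContDiff ℝ ∞ g →
    HasCompactSupport g → ‖∑' m : ℤ, g m - ∫ x, g x‖ ≤ C * ∫ x, ‖iteratedDeriv k g x‖ := by
  refine ⟨∑' m : ℤ, 1 / |(m:ℝ)| ^ k, tsum_nonneg fun _ => by positivity, ?_⟩
  intro g hg hg'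
  have hs : Summable fun m : ℤ => 1 / |(m:ℝ)| ^ k := by
    have := (Real.summable_one_div_int_pow (p := k)).2 (by omega)
    simpa [abs_pow, abs_div] using this.abs
  have hinteg : ∀ j : ℕ, Integrable (iteratedDeriv j g) := by
    intro j
    exact (hg.continuous_iteratedDeriv j (by exact_mod_cast le_top)).integrable_of_hasCompactSupport
      (stmtE_iter_cs hg' j)
  set A := ∫ x, ‖iteratedDeriv k g x‖ with hA
  have hA0 : 0 ≤ A := by positivity
  have hF : ∀ m : ℤ, m ≠ 0 → ‖𝓕 g (m:ℝ)‖ ≤ 1 / |(m:ℝ)| ^ k * A := by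
    intro m hm
    have h1 := congrFun (Real.fourier_iteratedDeriv (N := ⊤) (n := k) hg (fun j _ => hinteg j) le_top) (m:ℝ)
    have h2 : ‖𝓕 (iteratedDeriv k g) (m:ℝ)‖ ≤ A :=
      VectorFourier.norm_fourierIntegral_le_integral_norm _ _ _ _ _
    rw [h1, norm_smul, norm_pow] at h2
    have h3 : (0:ℝ) < |(m:ℝ)| ^ k := by positivity
    rw [one_div, ← div_eq_inv_mul, le_div_iff₀ h3, mul_comm]
    refine le_trans ?_ h2
    gcongr
    simp only [norm_mul, Complex.norm_real, Complex.norm_I, Complex.norm_ofNat, Real.norm_eq_abs, mul_one]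
    have := Real.pi_gt_three
    rw [abs_of_pos Real.pi_pos]
    nlinarith [abs_nonneg (m:ℝ)]
  have hsF : Summable fun m : ℤ => 𝓕 g (m:ℝ) := by
    refine Summable.of_norm_bounded_eventually (hs.mul_right A) ?_
    rw [Filter.eventually_cofinite]
    refine (Set.finite_singleton (0:ℤ)).subset ?_
    intro m hm
    by_contra h
    exact hm (hF m h)
  have hP := SchwartzMap.tsum_eq_tsum_fourier (hg'.toSchwartzMap hg) 0
  have hP' : ∑' n : ℤ, g n = ∑' n : ℤ, 𝓕 g (n:ℝ) := by
    have hcoe : ⇑(hg'.toSchwartzMap hg) = g := rfl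
    simp only [SchwartzMap.fourier_coe, hcoe] at hP
    simpa using hP
  rw [hP', hsF.tsum_eq_add_tsum_ite 0]
  have h0 : 𝓕 g ((0:ℤ):ℝ) = ∫ x, g x := by
    simp [Real.fourier_eq]
  rw [h0, add_sub_cancel_left, ← tsum_mul_right]
  refine tsum_of_norm_bounded (hs.mul_right A).hasSum ?_
  intro m
  split_ifs with h
  · simp; positivity
  · exact hF m h

end stmtE1

section stmtE2
open FourierTransform ContDiff MeasureTheory

/-- partial derivative in the zeroth coordinate -/
noncomputable def stmtE_pd {n : ℕ} (Φ : (Fin (n+1) → ℝ) → ℂ) : (Fin (n+1) → ℝ) → ℂ :=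
  fun v => fderiv ℝ Φ v (Pi.single 0 1)

lemma stmtE_pd_contDiff {n : ℕ} {Φ : (Fin (n+1) → ℝ) → ℂ} (h : ContDiff ℝ ∞ Φ) :
    ContDiff ℝ ∞ (stmtE_pd Φ) :=
  (h.fderiv_right (by simp)).clm_apply contDiff_const

lemma stmtE_pd_cs {n : ℕ} {Φ : (Fin (n+1) → ℝ) → ℂ} (h : HasCompactSupport Φ) :
    HasCompactSupport (stmtE_pd Φ) := h.fderiv_apply (𝕜 := ℝ) _

lemma stmtE_pd_hasDerivAt {n : ℕ} {Φ : (Fin (n+1) → ℝ) → ℂ} (h : ContDiff ℝ ∞ Φ) (T : ℝ)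
    (y : Fin n → ℝ) (t : ℝ) :
    HasDerivAt (fun t => Φ (Fin.cons (t / T) y)) ((1 / T : ℝ) • stmtE_pd Φ (Fin.cons (t / T) y)) t := by
  have h1 : HasDerivAt (fun t : ℝ => (Fin.cons (t / T) y : Fin (n+1) → ℝ)) ((1 / T : ℝ) • Pi.single 0 1) t := by
    rw [hasDerivAt_pi]
    intro i
    refine Fin.cases ?_ (fun j => ?_) i
    · simpa using (hasDerivAt_id t).div_const T
    · simpa using hasDerivAt_const t (y j)
  have h2 := ((h.differentiable (by simp)) (Fin.cons (t / T) y)).hasFDerivAt.comp_hasDerivAt t h1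
  simpa [stmtE_pd, Function.comp_def] using h2

lemma stmtE_iter {n : ℕ} {Φ : (Fin (n+1) → ℝ) → ℂ} (h : ContDiff ℝ ∞ Φ) (T : ℝ)
    (y : Fin n → ℝ) (k : ℕ) :
    iteratedDeriv k (fun t => Φ (Fin.cons (t / T) y)) =
      fun t => ((1 / T : ℝ) ^ k) • ((stmtE_pd^[k] Φ) (Fin.cons (t / T) y)) := by
  induction k generalizing Φ with
  | zero => simp
  | succ k ih =>
    rw [iteratedDeriv_succ']
    have : deriv (fun t => Φ (Fin.cons (t / T) y)) =
        fun t => (1 / T : ℝ) • stmtE_pd Φ (Fin.cons (t / T) y) := by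
      ext t; exact (stmtE_pd_hasDerivAt h T y t).deriv
    rw [this]
    ext t
    have h3 := iteratedDeriv_const_smul_field (n := k) (x := t) (1 / T : ℝ) (f := fun t => stmtE_pd Φ (Fin.cons (t / T) y))
    have h4 : (fun t => (1 / T : ℝ) • stmtE_pd Φ (Fin.cons (t / T) y)) = 
      (1 / T : ℝ) • (fun t => stmtE_pd Φ (Fin.cons (t / T) y)) := rfl
    rw [h4, h3, ih (stmtE_pd_contDiff h)]
    simp only [smul_smul, Function.iterate_succ, Function.comp, pow_succ']

lemma stmtE_pdk {n : ℕ} {Φ : (Fin (n+1) → ℝ) → ℂ} (h : ContDiff ℝ ∞ Φ) (h' : HasCompactSupport Φ)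
    (k : ℕ) : ContDiff ℝ ∞ (stmtE_pd^[k] Φ) ∧ HasCompactSupport (stmtE_pd^[k] Φ) := by
  induction k generalizing Φ with
  | zero => exact ⟨h, h'⟩
  | succ k ih => exact ih (stmtE_pd_contDiff h) (stmtE_pd_cs h')

lemma stmtE_bound {E : Type*} [NormedAddCommGroup E] {Φ : E → ℂ}
    (h' : HasCompactSupport Φ) : ∃ M : ℝ, 1 ≤ M ∧ ∀ x, Φ x ≠ 0 → ‖x‖ ≤ M := by
  obtain ⟨M, hM⟩ := h'.isCompact.isBounded.exists_norm_le
  exact ⟨max 1 M, le_max_left _ _, fun x hx => (hM x (subset_tsupport _ hx)).trans (le_max_right _ _)⟩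

lemma stmtE_bound_val {E : Type*} [NormedAddCommGroup E] {Φ : E → ℂ} (hc : Continuous Φ)
    (h' : HasCompactSupport Φ) : ∃ D : ℝ, 0 ≤ D ∧ ∀ x, ‖Φ x‖ ≤ D := by
  obtain ⟨D, hD⟩ := h'.exists_bound_of_continuous hc
  exact ⟨max 0 D, le_max_left _ _, fun x => (hD x).trans (le_max_right _ _)⟩

/-- marginal -/
noncomputable def stmtE_marg {n : ℕ} (Φ : (Fin (n+1) → ℝ) → ℂ) : (Fin n → ℝ) → ℂ :=
  fun y => ∫ t, Φ (Fin.cons t y)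

lemma stmtE_cons_contDiff {n : ℕ} : ContDiff ℝ ∞ (fun p : (Fin n → ℝ) × ℝ => (Fin.cons p.2 p.1 : Fin (n+1) → ℝ)) := by
  rw [contDiff_pi]
  intro i
  refine Fin.cases ?_ (fun j => ?_) i
  · simpa using contDiff_snd
  · simp only [Fin.cons_succ]; fun_prop

lemma stmtE_norm_cons {n : ℕ} (t : ℝ) (y : Fin n → ℝ) : |t| ≤ ‖(Fin.cons t y : Fin (n+1) → ℝ)‖ ∧
    ‖y‖ ≤ ‖(Fin.cons t y : Fin (n+1) → ℝ)‖ := by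
  constructor
  · simpa using norm_le_pi_norm (Fin.cons t y : Fin (n+1) → ℝ) 0
  · rw [pi_norm_le_iff_of_nonneg (norm_nonneg _)]
    intro i
    simpa using norm_le_pi_norm (Fin.cons t y : Fin (n+1) → ℝ) i.succ

lemma stmtE_marg_contDiff {n : ℕ} {Φ : (Fin (n+1) → ℝ) → ℂ} (h : ContDiff ℝ ∞ Φ)
    (h' : HasCompactSupport Φ) : ContDiff ℝ ∞ (stmtE_marg Φ) := by
  obtain ⟨M, hM1, hM⟩ := stmtE_bound h'
  rw [← contDiffOn_univ]
  have := contDiffOn_convolution_right_with_param_comp (𝕜 := ℝ) (n := ⊤) (μ := (volume : Measure ℝ))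
    (ContinuousLinearMap.lsmul ℝ ℝ (E := ℂ)) (s := (Set.univ : Set (Fin n → ℝ)))
    (v := fun _ => (0:ℝ)) contDiffOn_const (f := fun _ => (1:ℝ))
    (g := fun y t => Φ (Fin.cons (-t) y)) (k := Set.Icc (-M) M) isOpen_univ isCompact_Icc ?_
    (locallyIntegrable_const _) ?_
  · refine this.congr ?_
    intro y _
    simp [stmtE_marg, convolution]
  · intro p x _ hx
    by_contra hne
    apply hx
    have := (stmtE_norm_cons (-x) p).1.trans (hM _ hne)
    rw [abs_neg] at this
    exact abs_le.1 this
  · rw [Set.univ_prod_univ, contDiffOn_univ]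
    have h3 : ContDiff ℝ ∞ (fun p : (Fin n → ℝ) × ℝ => (p.1, -p.2)) := by fun_prop
    exact h.comp (stmtE_cons_contDiff.comp h3)

lemma stmtE_marg_cs {n : ℕ} {Φ : (Fin (n+1) → ℝ) → ℂ}
    (h' : HasCompactSupport Φ) : HasCompactSupport (stmtE_marg Φ) := by
  obtain ⟨M, hM1, hM⟩ := stmtE_bound h'
  refine HasCompactSupport.of_support_subset_isCompact (isCompact_closedBall (0 : Fin n → ℝ) M) ?_
  intro y hy
  by_contra hn
  apply hy
  have : ∀ t, Φ (Fin.cons t y) = 0 := by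
    intro t
    by_contra hne
    apply hn
    simpa using (stmtE_norm_cons t y).2.trans (hM _ hne)
  simp [stmtE_marg, this]

end stmtE2

section stmtE3
open FourierTransform ContDiff MeasureTheory

lemma stmtE_line {n : ℕ} {Φ : (Fin (n+1) → ℝ) → ℂ} (h : ContDiff ℝ ∞ Φ) (h' : HasCompactSupport Φ)
    (k : ℕ) (hk : 2 ≤ k) : ∃ C : ℝ, 0 ≤ C ∧ ∀ T : ℝ, 1 ≤ T → ∀ y : Fin n → ℝ,
      ‖∑' m : ℤ, Φ (Fin.cons (m / T) y) - T * stmtE_marg Φ y‖ ≤ C * (T * (1 / T) ^ k) := by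
  obtain ⟨C, hC0, hC⟩ := stmtE_poisson1 k hk
  obtain ⟨hd, hcs⟩ := stmtE_pdk h h' k
  obtain ⟨M, hM1, hM⟩ := stmtE_bound hcs
  obtain ⟨M', hM1', hM'⟩ := stmtE_bound h'
  obtain ⟨D, hD0, hD⟩ := stmtE_bound_val hd.continuous hcs
  refine ⟨C * (D * (2 * M)), by positivity, ?_⟩
  intro T hT y
  have hT0 : 0 < T := by linarith
  have hg : ContDiff ℝ ∞ (fun t : ℝ => Φ (Fin.cons (t / T) y)) := by
    have h3 : ContDiff ℝ ∞ (fun t : ℝ => (y, t / T)) := by fun_prop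
    exact h.comp (stmtE_cons_contDiff.comp h3)
  have hgcs : HasCompactSupport (fun t : ℝ => Φ (Fin.cons (t / T) y)) := by
    refine HasCompactSupport.of_support_subset_isCompact (isCompact_closedBall (0 : ℝ) (M' * T)) ?_
    intro t ht
    have := (stmtE_norm_cons (t / T) y).1.trans (hM' _ ht)
    rw [abs_div, abs_of_pos hT0, div_le_iff₀ hT0] at this
    simpa using this
  have h1 := hC _ hg hgcs
  have h2 : ∫ t, Φ (Fin.cons (t / T) y) = T * stmtE_marg Φ y := by
    have := Measure.integral_comp_div (fun t => Φ (Fin.cons t y)) T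
    rw [this, abs_of_pos hT0]; simp [stmtE_marg]
  rw [h2] at h1
  refine h1.trans ?_
  rw [mul_assoc]
  refine mul_le_mul_of_nonneg_left ?_ hC0
  rw [stmtE_iter h]
  have hz : ∀ t, t ∉ Set.Icc (-(M * T)) (M * T) → 
      ‖((1 / T : ℝ) ^ k) • ((stmtE_pd^[k] Φ) (Fin.cons (t / T) y))‖ = 0 := by
    intro t ht
    rw [norm_eq_zero]
    by_contra hne
    apply ht
    have hne' := right_ne_zero_of_smul hne
    have := (stmtE_norm_cons (t / T) y).1.trans (hM _ hne')
    rw [abs_div, abs_of_pos hT0, div_le_iff₀ hT0] at this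
    exact abs_le.1 this
  rw [← setIntegral_eq_integral_of_forall_compl_eq_zero hz]
  have := norm_setIntegral_le_of_norm_le_const (μ := volume) (s := Set.Icc (-(M * T)) (M * T))
    (f := fun t => ‖((1 / T : ℝ) ^ k) • ((stmtE_pd^[k] Φ) (Fin.cons (t / T) y))‖)
    (C := (1 / T) ^ k * D) (by simp) (by
      intro t _
      rw [norm_norm, norm_smul, norm_pow, Real.norm_of_nonneg (by positivity : (0:ℝ) ≤ 1 / T)]
      gcongr; exact hD _)
  refine (le_abs_self _).trans (this.trans (le_of_eq ?_))
  rw [Measure.real, Real.volume_Icc, ENNReal.toReal_ofReal (by nlinarith)]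
  ring

lemma stmtE_box_card (n : ℕ) (L : ℝ) (hL : 0 ≤ L) :
    ((Finset.Icc (fun _ : Fin n => -⌊L⌋) (fun _ => ⌊L⌋)).card : ℝ) ≤ (2 * L + 1) ^ n := by
  rw [Pi.card_Icc]
  simp only [Int.card_Icc, Finset.prod_const, Finset.card_univ, Fintype.card_fin, Nat.cast_pow]
  have h0 : 0 ≤ ⌊L⌋ := Int.floor_nonneg.2 hL
  have h1 : (((⌊L⌋ + 1 - -⌊L⌋).toNat : ℕ) : ℝ) = 2 * ⌊L⌋ + 1 := by
    have : (((⌊L⌋ + 1 - -⌊L⌋).toNat : ℕ) : ℤ) = 2 * ⌊L⌋ + 1 := by omega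
    exact_mod_cast this
  rw [h1]
  have := Int.floor_le L
  have h0' : (0:ℝ) ≤ ⌊L⌋ := by exact_mod_cast h0
  gcongr

lemma stmtE_mem_box {n : ℕ} {M T : ℝ} (hT : 0 < T) (v : Fin n → ℤ)
    (h : ‖(fun i => (v i : ℝ) / T)‖ ≤ M) : v ∈ Finset.Icc (fun _ : Fin n => -⌊M * T⌋) (fun _ => ⌊M * T⌋) := by
  have : ∀ i, -⌊M * T⌋ ≤ v i ∧ v i ≤ ⌊M * T⌋ := by
    intro i
    have h1 := (norm_le_pi_norm (fun i => (v i : ℝ) / T) i).trans h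
    rw [Real.norm_eq_abs, abs_div, abs_of_pos hT, div_le_iff₀ hT, ← Int.cast_abs] at h1
    have := Int.le_floor.2 h1
    exact abs_le.1 this
  rw [Finset.mem_Icc]
  exact ⟨fun i => (this i).1, fun i => (this i).2⟩

lemma stmtE_summable {n : ℕ} {Φ : (Fin n → ℝ) → ℂ} (h' : HasCompactSupport Φ) {T : ℝ} (hT : 0 < T) :
    (Function.support fun v : Fin n → ℤ => Φ (fun i => v i / T)).Finite := by
  obtain ⟨M, hM1, hM⟩ := stmtE_bound h'
  refine (Finset.finite_toSet (Finset.Icc (fun _ : Fin n => -⌊M * T⌋) (fun _ => ⌊M * T⌋))).subset ?_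
  intro v hv
  exact stmtE_mem_box hT v (hM _ hv)

theorem stmtE_lattice (n : ℕ) : ∀ Φ : (Fin n → ℝ) → ℂ, ContDiff ℝ ∞ Φ → HasCompactSupport Φ →
    ∃ R : ℂ, ∀ k : ℕ, ∃ C : ℝ, 0 ≤ C ∧ ∀ T : ℝ, 1 ≤ T →
      ‖∑' v : Fin n → ℤ, Φ (fun i => v i / T) - R * T ^ n‖ ≤ C * (1 / T) ^ k := by
  induction n with
  | zero =>
    intro Φ _ _
    refine ⟨Φ 0, fun k => ⟨0, le_rfl, fun T hT => ?_⟩⟩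
    rw [tsum_eq_single (default : Fin 0 → ℤ) (by intro b hb; exact absurd (Subsingleton.elim _ _) hb)]
    rw [show (fun i => ((default : Fin 0 → ℤ) i : ℝ) / T) = 0 from Subsingleton.elim _ _]
    simp
  | succ n ih =>
    intro Φ h h'
    obtain ⟨R, hR⟩ := ih _ (stmtE_marg_contDiff h h') (stmtE_marg_cs h')
    refine ⟨R, fun k => ?_⟩
    obtain ⟨C1, hC10, hC1⟩ := hR (k + 1)
    obtain ⟨C2, hC20, hC2⟩ := stmtE_line h h' (n + 2 + k) (by omega)
    obtain ⟨M, hM1, hM⟩ := stmtE_bound h'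
    refine ⟨(2 * M + 1) ^ n * C2 + C1, by positivity, fun T hT => ?_⟩
    have hT0 : 0 < T := by linarith
    have hcons : ∀ (m : ℤ) (v : Fin n → ℤ), (fun i => ((Fin.cons m v : Fin (n+1) → ℤ) i : ℝ) / T)
        = Fin.cons (m / T) (fun i => v i / T) := by
      intro m v; ext i; refine Fin.cases ?_ (fun j => ?_) i <;> simp
    -- rewrite the sum
    have hsum : ∑' v : Fin (n+1) → ℤ, Φ (fun i => v i / T) =
        ∑' v : Fin n → ℤ, ∑' m : ℤ, Φ (Fin.cons (m / T) (fun i => v i / T)) := by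
      let e : (Fin n → ℤ) × ℤ ≃ (Fin (n+1) → ℤ) := (Equiv.prodComm _ _).trans (Fin.consEquiv fun _ => ℤ)
      rw [← e.tsum_eq, Summable.tsum_prod]
      · congr 1; ext v; congr 1; ext m
        rw [← hcons]; rfl
      · have : Summable fun v : Fin (n+1) → ℤ => Φ (fun i => v i / T) :=
          summable_of_hasFiniteSupport (stmtE_summable h' hT0)
        exact (e.summable_iff (f := fun v : Fin (n+1) → ℤ => Φ (fun i => v i / T))).2 this
    set B := Finset.Icc (fun _ : Fin n => -⌊M * T⌋) (fun _ => ⌊M * T⌋) with hB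
    have hs1 : ∑' v : Fin n → ℤ, ∑' m : ℤ, Φ (Fin.cons (m / T) (fun i => v i / T)) =
        ∑ v ∈ B, ∑' m : ℤ, Φ (Fin.cons (m / T) (fun i => v i / T)) := by
      refine tsum_eq_sum fun v hv => ?_
      have : ∀ m : ℤ, Φ (Fin.cons (m / T) (fun i => v i / T)) = 0 := by
        intro m
        by_contra hne
        exact hv (stmtE_mem_box hT0 v ((stmtE_norm_cons _ _).2.trans (hM _ hne)))
      simp [this]
    have hs2 : ∑' v : Fin n → ℤ, stmtE_marg Φ (fun i => v i / T) =
        ∑ v ∈ B, stmtE_marg Φ (fun i => v i / T) := by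
      refine tsum_eq_sum fun v hv => ?_
      have : ∀ t : ℝ, Φ (Fin.cons t (fun i => v i / T)) = 0 := by
        intro m
        by_contra hne
        exact hv (stmtE_mem_box hT0 v ((stmtE_norm_cons _ _).2.trans (hM _ hne)))
      simp [stmtE_marg, this]
    have hd : ‖∑ v ∈ B, ∑' m : ℤ, Φ (Fin.cons (m / T) (fun i => v i / T)) -
        T * ∑ v ∈ B, stmtE_marg Φ (fun i => v i / T)‖ ≤ B.card * (C2 * (T * (1 / T) ^ (n + 2 + k))) := by
      rw [Finset.mul_sum, ← Finset.sum_sub_distrib]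
      refine (norm_sum_le_of_le _ fun v _ => hC2 T hT _).trans ?_
      simp
    have hcard : (B.card : ℝ) ≤ (2 * M + 1) ^ n * T ^ n := by
      refine (stmtE_box_card n (M * T) (by positivity)).trans ?_
      rw [← mul_pow]
      gcongr
      nlinarith
    have hm := hC1 T hT
    rw [hs2] at hm
    rw [hsum, hs1]
    have e1 : (∑ v ∈ B, ∑' m : ℤ, Φ (Fin.cons (m / T) (fun i => v i / T))) - R * T ^ (n+1) =
        (∑ v ∈ B, ∑' m : ℤ, Φ (Fin.cons (m / T) (fun i => v i / T)) -
        T * ∑ v ∈ B, stmtE_marg Φ (fun i => v i / T)) +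
        T * (∑ v ∈ B, stmtE_marg Φ (fun i => v i / T) - R * T ^ n) := by ring
    rw [e1, add_mul]
    refine (norm_add_le _ _).trans (add_le_add (hd.trans ?_) ?_)
    · calc (B.card : ℝ) * (C2 * (T * (1 / T) ^ (n + 2 + k)))
          ≤ ((2 * M + 1) ^ n * T ^ n) * (C2 * (T * (1 / T) ^ (n + 2 + k))) := by gcongr
        _ = (2 * M + 1) ^ n * C2 * (1 / T) ^ k * (1 / T) := by
          rw [one_div, inv_pow, inv_pow, pow_add, pow_add]; field_simp
        _ ≤ (2 * M + 1) ^ n * C2 * (1 / T) ^ k * 1 := by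
          gcongr
          rw [div_le_one hT0]; exact hT
        _ = _ := by ring
    · rw [norm_mul, Complex.norm_real, Real.norm_of_nonneg hT0.le]
      calc T * _ ≤ T * (C1 * (1 / T) ^ (k + 1)) := by gcongr
        _ = C1 * (1 / T) ^ k := by rw [pow_succ]; field_simp

end stmtE3

section stmtF1
open NumberField NumberField.mixedEmbedding NumberField.InfinitePlace ContDiff
open scoped Classical

variable {K : Type*} [Field K] [NumberField K]

lemma stmtF_normAtPlace_le (w : InfinitePlace K) (v : mixedSpace K) : normAtPlace w v ≤ ‖v‖ := by
  rw [norm_eq_sup'_normAtPlace]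
  exact Finset.le_sup' (fun w => normAtPlace w v) (Finset.mem_univ w)

lemma stmtF_norm_sq_smooth : ContDiff ℝ ∞ (fun v : mixedSpace K => (mixedEmbedding.norm v) ^ 2) := by
  have : ∀ w : InfinitePlace K, ContDiff ℝ ∞ (fun v : mixedSpace K => (normAtPlace w v) ^ 2) := by
    intro w
    rcases isReal_or_isComplex w with hw | hw
    · simp_rw [normAtPlace_apply_of_isReal hw]
      simp_rw [Real.norm_eq_abs, sq_abs]
      fun_prop
    · simp_rw [normAtPlace_apply_of_isComplex hw]
      have h1 : ContDiff ℝ ∞ (fun v : mixedSpace K => v.2 ⟨w, hw⟩) := by fun_prop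
      exact (contDiff_norm_sq ℝ).comp h1
  simp_rw [mixedEmbedding.norm_apply, ← Finset.prod_pow]
  apply contDiff_prod
  intro w _
  have := (this w).pow (mult w)
  convert this using 2
  ring

/-- local finiteness of the unit action -/
lemma stmtF_locfin (v : mixedSpace K) (hv : mixedEmbedding.norm v ≠ 0) (B : ℝ) :
    ∃ S : Finset (𝓞 K)ˣ, ∀ᶠ y in nhds v, ∀ u : (𝓞 K)ˣ, ‖u • y‖ ≤ B → u ∈ S := by
  rw [mixedEmbedding.norm_ne_zero_iff] at hv
  have hpos : ∀ w, 0 < normAtPlace w v := fun w => lt_of_le_of_ne (normAtPlace_nonneg w v) (hv w).symm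
  obtain ⟨δ, hδ, hδv⟩ : ∃ δ > 0, ∀ w : InfinitePlace K, δ < normAtPlace w v := by
    refine ⟨(Finset.univ.inf' Finset.univ_nonempty fun w => normAtPlace w v) / 2, ?_, ?_⟩
    · apply half_pos
      rw [Finset.lt_inf'_iff]
      exact fun w _ => hpos w
    · intro w
      have h1 : (Finset.univ.inf' Finset.univ_nonempty fun w => normAtPlace w v) ≤ normAtPlace w v :=
        Finset.inf'_le _ (Finset.mem_univ w)
      have := hpos w
      linarith
  have hfin := Embeddings.finite_of_norm_le K ℂ (B / δ)
  have hfin2 : {u : (𝓞 K)ˣ | ∀ φ : K →+* ℂ, ‖φ (u : K)‖ ≤ B / δ}.Finite := by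
    refine Set.Finite.of_finite_image (f := fun u : (𝓞 K)ˣ => (u : K)) (hfin.subset ?_) ?_
    · rintro _ ⟨u, hu, rfl⟩
      exact ⟨RingOfIntegers.isIntegral_coe _, hu⟩
    · intro a _ b _ h
      exact Units.ext (RingOfIntegers.ext h)
  refine ⟨hfin2.toFinset, ?_⟩
  have hev : ∀ᶠ y in nhds v, ∀ w : InfinitePlace K, δ < normAtPlace w y := by
    rw [Filter.eventually_all]
    intro w
    exact (continuous_normAtPlace w).continuousAt.eventually_const_lt (hδv w)
  filter_upwards [hev] with y hy u hu
  simp only [Set.Finite.mem_toFinset, Set.mem_ofPred_eq]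
  intro φ
  have h1 := (stmtF_normAtPlace_le (InfinitePlace.mk φ) (u • y)).trans hu
  rw [unitSMul_smul, map_mul, normAtPlace_apply, InfinitePlace.apply] at h1
  rw [le_div_iff₀ hδ]
  refine le_trans ?_ h1
  exact mul_le_mul_of_nonneg_left (hy _).le (norm_nonneg _)

lemma stmtF_B : ∃ B : ℝ, 0 < B ∧ ∀ v : mixedSpace K, mixedEmbedding.norm v ≠ 0 →
    mixedEmbedding.norm v ≤ 2 → ∃ u : (𝓞 K)ˣ, ‖u • v‖ ≤ B := by
  obtain ⟨C, hC⟩ := (fundamentalCone.isBounded_normLeOne K).exists_norm_le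
  refine ⟨max (2 * C) 1, by positivity, ?_⟩
  intro v hv hv2
  obtain ⟨u, hu⟩ := fundamentalCone.exists_unit_smul_mem hv
  refine ⟨u, ?_⟩
  have hmem : ((1 / 2 : ℝ) • (u • v)) ∈ fundamentalCone.normLeOne K := by
    refine ⟨fundamentalCone.smul_mem_of_mem hu (by norm_num), ?_⟩
    simp only [Set.mem_ofPred_eq]
    rw [mixedEmbedding.norm_smul, norm_unit_smul]
    have : |(1/2 : ℝ)| ^ Module.finrank ℚ K ≤ 1 / 2 := by
      rw [abs_of_pos (by norm_num)]
      exact pow_le_of_le_one (by norm_num) (by norm_num) (Module.finrank_pos).ne'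
    nlinarith [mixedEmbedding.norm_nonneg v]
  have := hC _ hmem
  rw [_root_.norm_smul] at this
  rw [Real.norm_eq_abs, abs_of_pos (by norm_num)] at this
  refine le_max_of_le_left ?_
  linarith

lemma stmtF_smul_smooth (u : (𝓞 K)ˣ) : ContDiff ℝ ∞ (fun v : mixedSpace K => u • v) := by
  simp_rw [unitSMul_smul]
  exact contDiff_const.mul contDiff_id

lemma stmtF_Phi (g : ℝ → ℝ) (hg : ContDiff ℝ ∞ g) (hg1 : ∀ y, g y ≠ 0 → 1 < y ∧ y < 2) :
    ∃ Φ : mixedSpace K → ℂ, ContDiff ℝ ∞ Φ ∧ HasCompactSupport Φ ∧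
      (∀ v, mixedEmbedding.norm v = 0 → Φ v = 0) ∧
      (∀ v, mixedEmbedding.norm v ≠ 0 → (Function.support fun u : (𝓞 K)ˣ => Φ (u • v)).Finite ∧
        ∑' u : (𝓞 K)ˣ, Φ (u • v) = g (mixedEmbedding.norm v ^ 2)) := by
  obtain ⟨B, hB, hBu⟩ := stmtF_B (K := K)
  let b : ContDiffBump (0 : mixedSpace K) := ⟨B, B + 1, hB, by linarith⟩
  have hbs : ContDiff ℝ ∞ (fun v => b v) := b.contDiff
  have hb0 : ∀ v, 0 ≤ b v := fun v => b.nonneg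
  have hb1 : ∀ v, ‖v‖ ≤ B → b v = 1 := fun v hv => b.one_of_mem_closedBall (by simpa using hv)
  have hb2 : ∀ v, b v ≠ 0 → ‖v‖ ≤ B + 1 := by
    intro v hv
    have : v ∈ Function.support b := hv
    rw [b.support_eq] at this
    simpa using (Metric.ball_subset_closedBall this)
  let G : mixedSpace K → ℝ := fun v => ∑' u : (𝓞 K)ˣ, b (u • v)
  have hGfin : ∀ v, mixedEmbedding.norm v ≠ 0 → ∃ S : Finset (𝓞 K)ˣ, ∀ᶠ y in nhds v,
      (∀ u : (𝓞 K)ˣ, b (u • y) ≠ 0 → u ∈ S) ∧ G y = ∑ u ∈ S, b (u • y) := by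
    intro v hv
    obtain ⟨S, hS⟩ := stmtF_locfin v hv (B + 1)
    refine ⟨S, ?_⟩
    filter_upwards [hS] with y hy
    refine ⟨fun u hu => hy u (hb2 _ hu), ?_⟩
    refine tsum_eq_sum fun u hu => ?_
    by_contra hne
    exact hu (hy u (hb2 _ hne))
  have hGpos : ∀ v, mixedEmbedding.norm v ≠ 0 → mixedEmbedding.norm v ≤ 2 → 0 < G v := by
    intro v hv hv2
    obtain ⟨S, hS⟩ := hGfin v hv
    obtain ⟨h1, h2⟩ := hS.self_of_nhds
    rw [h2]
    obtain ⟨u, hu⟩ := hBu v hv hv2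
    have := hb1 _ hu
    refine Finset.sum_pos' (fun _ _ => hb0 _) ⟨u, h1 u (by rw [this]; exact one_ne_zero), by rw [this]; exact one_pos⟩
  have hGinv : ∀ v (u : (𝓞 K)ˣ), G (u • v) = G v := by
    intro v u
    show ∑' u', b (u' • (u • v)) = ∑' u', b (u' • v)
    simp_rw [← mul_smul]
    exact (Equiv.mulRight u).tsum_eq (fun u' => b (u' • v))
  have hle : ∀ v : mixedSpace K, mixedEmbedding.norm v ^ 2 ≤ 2 → mixedEmbedding.norm v ≤ 2 := by
    intro v hv
    nlinarith [mixedEmbedding.norm_nonneg v]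
  refine ⟨fun v => ((g (mixedEmbedding.norm v ^ 2) * b v / G v : ℝ) : ℂ), ?_, ?_, ?_, ?_⟩
  · rw [contDiff_iff_contDiffAt]
    intro v
    have hcont : Continuous (fun v : mixedSpace K => mixedEmbedding.norm v ^ 2) := stmtF_norm_sq_smooth.continuous
    by_cases hv : mixedEmbedding.norm v ^ 2 < 1 ∨ 2 < mixedEmbedding.norm v ^ 2
    · have hz : ∀ᶠ y in nhds v, g (mixedEmbedding.norm y ^ 2) = 0 := by
        rcases hv with hv | hv
        · filter_upwards [hcont.continuousAt.eventually_lt_const hv] with y hy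
          by_contra hne
          exact absurd (hg1 _ hne).1 (not_lt.mpr hy.le)
        · filter_upwards [hcont.continuousAt.eventually_const_lt hv] with y hy
          by_contra hne
          exact absurd (hg1 _ hne).2 (not_lt.mpr hy.le)
      have : (fun v => ((g (mixedEmbedding.norm v ^ 2) * b v / G v : ℝ) : ℂ)) =ᶠ[nhds v] fun _ => 0 := by
        filter_upwards [hz] with y hy
        simp [hy]
      exact contDiffAt_const.congr_of_eventuallyEq this
    · push Not at hv
      have hv0 : mixedEmbedding.norm v ≠ 0 := by
        intro h0
        rw [h0] at hv
        norm_num at hv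
      obtain ⟨S, hS⟩ := hGfin v hv0
      have hGs : ContDiffAt ℝ ∞ G v := by
        have h1 : ContDiffAt ℝ ∞ (fun y => ∑ u ∈ S, b (u • y)) v := by
          apply ContDiffAt.sum
          intro u _
          exact (hbs.comp (stmtF_smul_smooth u)).contDiffAt
        exact h1.congr_of_eventuallyEq (hS.mono fun y hy => hy.2)
      have h2 : ContDiffAt ℝ ∞ (fun v => g (mixedEmbedding.norm v ^ 2) * b v / G v) v := by
        refine ContDiffAt.div (ContDiffAt.mul ?_ hbs.contDiffAt) hGs (hGpos v hv0 (hle v hv.2)).ne'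
        exact (hg.comp stmtF_norm_sq_smooth).contDiffAt
      exact (Complex.ofRealCLM.contDiff.contDiffAt).comp v h2
  · refine HasCompactSupport.of_support_subset_isCompact (isCompact_closedBall (0 : mixedSpace K) (B+1)) ?_
    intro v hv
    have : b v ≠ 0 := by
      intro h
      apply hv
      simp [h]
    simpa using hb2 v this
  · intro v hv
    have : g 0 = 0 := by
      by_contra hne
      have := (hg1 _ hne).1
      norm_num at this
    simp [hv, this]
  · intro v hv
    obtain ⟨S, hS⟩ := hGfin v hv
    obtain ⟨h1, h2⟩ := hS.self_of_nhds
    constructor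
    · refine S.finite_toSet.subset ?_
      intro u hu
      apply h1
      intro h
      apply hu
      show ((g (mixedEmbedding.norm (u • v) ^ 2) * b (u • v) / G (u • v) : ℝ) : ℂ) = 0
      rw [h]
      simp only [mul_zero, zero_div, Complex.ofReal_zero]
    · simp_rw [norm_unit_smul, hGinv]
      rw [← Complex.ofReal_tsum]
      congr 1
      simp_rw [mul_div_right_comm]
      rw [tsum_mul_left]
      change g (mixedEmbedding.norm v ^ 2) / G v * G v = _
      by_cases hne : g (mixedEmbedding.norm v ^ 2) = 0
      · simp [hne]
      · exact div_mul_cancel₀ _ (hGpos v hv (hle v (hg1 _ hne).2.le)).ne'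
end stmtF1

section stmtF2
open NumberField NumberField.mixedEmbedding NumberField.InfinitePlace ContDiff
open scoped Classical nonZeroDivisors

variable {K : Type*} [Field K] [NumberField K]

lemma stmtF_latticeJ (J : Ideal (𝓞 K)) (hJ : J ≠ ⊥) : ∃ (b : Module.Basis (Fin (Module.finrank ℚ K)) ℝ (mixedSpace K))
    (e : (Fin (Module.finrank ℚ K) → ℤ) ≃ J), ∀ v, mixedEmbedding K (e v : 𝓞 K) = ∑ i, (v i : ℝ) • b i := by
  let I : (FractionalIdeal (𝓞 K)⁰ K)ˣ := Units.mk0 (J : FractionalIdeal (𝓞 K)⁰ K)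
    (by simpa using hJ)
  let b0 := fractionalIdealLatticeBasis K I
  have hcard : Fintype.card (Module.Free.ChooseBasisIndex ℤ I) = Module.finrank ℚ K := by
    rw [← Module.finrank_eq_card_chooseBasisIndex, fractionalIdeal_rank, RingOfIntegers.rank]
  let b := b0.reindex (Fintype.equivFinOfCardEq hcard)
  have hr : Set.range b = Set.range b0 := by
    rw [Module.Basis.range_reindex]
  have hex : ∀ v : Fin (Module.finrank ℚ K) → ℤ, ∃ a : J, mixedEmbedding K (a : 𝓞 K) = ∑ i, (v i : ℝ) • b i := by
    intro v
    have h1 : ∑ i, (v i : ℝ) • b i ∈ Submodule.span ℤ (Set.range b0) := by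
      rw [← hr]
      refine Submodule.sum_mem _ fun i _ => ?_
      rw [Int.cast_smul_eq_zsmul]
      exact Submodule.smul_mem _ _ (Submodule.subset_span ⟨i, rfl⟩)
    rw [mem_span_fractionalIdealLatticeBasis] at h1
    obtain ⟨x, hx, hxe⟩ := h1
    have : x ∈ (J : FractionalIdeal (𝓞 K)⁰ K) := hx
    rw [FractionalIdeal.mem_coeIdeal] at this
    obtain ⟨a, ha, rfl⟩ := this
    exact ⟨⟨a, ha⟩, hxe⟩
  choose ψ hψ using hex
  have hbij : Function.Bijective ψ := by
    constructor
    · intro v w hvw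
      have h1 := hψ v
      rw [hvw, hψ w] at h1
      have h2 := (Fintype.linearIndependent_iff.mp b.linearIndependent) (fun i => (v i : ℝ) - w i) (by
        simp_rw [sub_smul]
        rw [Finset.sum_sub_distrib, h1, sub_self])
      funext i
      have := h2 i
      exact_mod_cast (sub_eq_zero.mp this)
    · intro a
      have h1 : mixedEmbedding K (a : 𝓞 K) ∈ Submodule.span ℤ (Set.range b0) := by
        rw [mem_span_fractionalIdealLatticeBasis]
        refine ⟨_, ?_, rfl⟩
        show _ ∈ (J : FractionalIdeal (𝓞 K)⁰ K)
        rw [FractionalIdeal.mem_coeIdeal]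
        exact ⟨a, a.2, rfl⟩
      rw [← hr, Submodule.mem_span_range_iff_exists_fun] at h1
      obtain ⟨c, hc⟩ := h1
      refine ⟨c, ?_⟩
      have h2 := hψ c
      simp_rw [Int.cast_smul_eq_zsmul] at h2
      rw [hc] at h2
      have := mixedEmbedding_injective K h2
      exact Subtype.ext (RingOfIntegers.ext this)
  exact ⟨b, Equiv.ofBijective ψ hbij, hψ⟩

lemma stmtF_latticeSum (J : Ideal (𝓞 K)) (hJ : J ≠ ⊥) (Φ : mixedSpace K → ℂ) (hΦ : ContDiff ℝ ∞ Φ)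
    (hΦ' : HasCompactSupport Φ) :
    ∃ R : ℂ, (∀ T : ℝ, 1 ≤ T → (Function.support fun a : J => Φ ((1 / T) • mixedEmbedding K (a : 𝓞 K))).Finite) ∧
    ∀ k : ℕ, ∃ C : ℝ, 0 ≤ C ∧ ∀ T : ℝ, 1 ≤ T →
      ‖∑' a : J, Φ ((1 / T) • mixedEmbedding K (a : 𝓞 K)) - R * T ^ (Module.finrank ℚ K)‖ ≤ C * (1 / T) ^ k := by
  obtain ⟨b, e, he⟩ := stmtF_latticeJ J hJ
  let L := b.equivFunL.symm
  have hLs : ContDiff ℝ ∞ (Φ ∘ L) := hΦ.comp L.contDiff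
  have hLc : HasCompactSupport (Φ ∘ L) := hΦ'.comp_homeomorph L.toHomeomorph
  obtain ⟨R, hR⟩ := stmtE_lattice _ (Φ ∘ L) hLs hLc
  have hkey : ∀ T : ℝ, ∀ v, (Φ ∘ L) (fun i => v i / T) = Φ ((1 / T) • mixedEmbedding K (e v : 𝓞 K)) := by
    intro T v
    rw [he]
    show Φ (L _) = _
    congr 1
    rw [Finset.smul_sum]
    have : L (fun i => (v i : ℝ) / T) = ∑ i, ((v i : ℝ) / T) • b i := b.equivFun_symm_apply _
    rw [this]
    refine Finset.sum_congr rfl fun i _ => ?_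
    rw [smul_smul]
    congr 1
    ring
  refine ⟨R, ?_, ?_⟩
  · intro T hT
    have h1 := stmtE_summable hLc (T := T) (by linarith)
    simp_rw [hkey] at h1
    have h2 := h1.image e
    refine h2.subset ?_
    intro a ha
    exact ⟨e.symm a, by simpa using ha, by simp⟩
  · intro k
    obtain ⟨C, hC, h⟩ := hR k
    refine ⟨C, hC, fun T hT => ?_⟩
    have := h T hT
    simp_rw [hkey] at this
    rwa [e.tsum_eq (fun a : J => Φ ((1 / T) • mixedEmbedding K (a : 𝓞 K)))] at this
end stmtF2

section stmtF3
open NumberField NumberField.mixedEmbedding NumberField.InfinitePlace ContDiff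
open scoped Classical nonZeroDivisors

variable {K : Type*} [Field K] [NumberField K]

set_option maxHeartbeats 1000000 in
lemma stmtF_classSum (c : ClassGroup (𝓞 K)) (g : ℝ → ℝ) (hg : ContDiff ℝ ∞ g) (hg1 : ∀ y, g y ≠ 0 → 1 < y ∧ y < 2) :
    ∃ R : ℂ, ∃ M : ℝ, 0 ≤ M ∧ ∀ t : ℝ, 0 < t → t ≤ 1 →
      ‖∑' I : {I : (Ideal (𝓞 K))⁰ // ClassGroup.mk0 I = c},
        ((g (((Ideal.absNorm (I.1 : Ideal (𝓞 K)) : ℝ) * t) ^ 2) : ℝ) : ℂ) - R / t‖ ≤ M * t := by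
  obtain ⟨J, hJ⟩ := ClassGroup.mk0_surjective c⁻¹
  have hJ0 : (J : Ideal (𝓞 K)) ≠ ⊥ := nonZeroDivisors.coe_ne_zero J
  obtain ⟨Φ, hΦs, hΦc, hΦ0, hΦu⟩ := stmtF_Phi (K := K) g hg hg1
  obtain ⟨R, hfin, hR⟩ := stmtF_latticeSum (J : Ideal (𝓞 K)) hJ0 Φ hΦs hΦc
  set n := Module.finrank ℚ K with hn
  have hnpos : n ≠ 0 := (Module.finrank_pos (R := ℚ) (M := K)).ne'
  have hNJ : (1 : ℝ) ≤ Ideal.absNorm (J : Ideal (𝓞 K)) := by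
    have : Ideal.absNorm (J : Ideal (𝓞 K)) ≠ 0 := by
      rw [ne_eq, Ideal.absNorm_eq_zero_iff]
      exact hJ0
    exact_mod_cast Nat.one_le_iff_ne_zero.mpr this
  have hgen : ∀ I : {I : (Ideal (𝓞 K))⁰ // ClassGroup.mk0 I = c}, ∃ a : 𝓞 K, a ≠ 0 ∧
      (I.1 : Ideal (𝓞 K)) * J = Ideal.span {a} := by
    intro I
    have h1 : ClassGroup.mk0 (I.1 * J) = 1 := by rw [map_mul, I.2, hJ, mul_inv_cancel]
    rw [ClassGroup.mk0_eq_one_iff] at h1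
    obtain ⟨a, ha⟩ := h1.principal
    refine ⟨a, ?_, ?_⟩
    · rintro rfl
      have : ((I.1 * J : (Ideal (𝓞 K))⁰) : Ideal (𝓞 K)) = ⊥ := by simpa using ha
      exact nonZeroDivisors.coe_ne_zero _ this
    · simpa using ha
  choose α hα0 hα using hgen
  have hαJ : ∀ I (u : (𝓞 K)ˣ), (u : 𝓞 K) * α I ∈ (J : Ideal (𝓞 K)) := by
    intro I u
    apply Ideal.mul_mem_left
    have : α I ∈ (I.1 : Ideal (𝓞 K)) * J := by rw [hα]; exact Ideal.mem_span_singleton_self _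
    have h2 : (I.1 : Ideal (𝓞 K)) * (J : Ideal (𝓞 K)) ≤ (J : Ideal (𝓞 K)) := Ideal.mul_le_right
    exact h2 this
  let θ : {I : (Ideal (𝓞 K))⁰ // ClassGroup.mk0 I = c} × (𝓞 K)ˣ → (J : Ideal (𝓞 K)) :=
    fun p => ⟨(p.2 : 𝓞 K) * α p.1, hαJ p.1 p.2⟩
  have hθ : Function.Injective θ := by
    rintro ⟨I, u⟩ ⟨I', u'⟩ h
    have h1 : (u : 𝓞 K) * α I = u' * α I' := congrArg Subtype.val h
    have h2 : Ideal.span {α I} = Ideal.span {α I'} := by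
      rw [← Ideal.span_singleton_mul_left_unit u.isUnit (α I), h1,
        Ideal.span_singleton_mul_left_unit u'.isUnit (α I')]
    rw [← hα, ← hα] at h2
    have h3 : (I.1 : Ideal (𝓞 K)) = I'.1 := mul_right_cancel₀ hJ0 h2
    have h4 : I = I' := Subtype.ext (Subtype.ext h3)
    subst h4
    have h5 : (u : 𝓞 K) = u' := mul_right_cancel₀ (hα0 I) h1
    rw [Units.ext h5]
  have hθr : ∀ a : (J : Ideal (𝓞 K)), (a : 𝓞 K) ≠ 0 → a ∈ Set.range θ := by
    intro a ha
    have hdvd : (J : Ideal (𝓞 K)) ∣ Ideal.span {(a : 𝓞 K)} := by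
      rw [Ideal.dvd_span_singleton]
      exact a.2
    obtain ⟨I0, hI0⟩ := hdvd
    have hI0n : I0 ≠ ⊥ := by
      rintro rfl
      rw [Ideal.mul_bot, Ideal.span_singleton_eq_bot] at hI0
      exact ha hI0
    let I : (Ideal (𝓞 K))⁰ := ⟨I0, mem_nonZeroDivisors_of_ne_zero hI0n⟩
    have hI : ClassGroup.mk0 I = c := by
      have h1 : ClassGroup.mk0 (I * J) = 1 := by
        rw [ClassGroup.mk0_eq_one_iff]
        refine ⟨(a : 𝓞 K), ?_⟩
        show I0 * J = _
        rw [mul_comm, ← hI0]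
      rw [map_mul, hJ, mul_inv_eq_one] at h1
      exact h1
    have h2 := hα ⟨I, hI⟩
    have h3 : Ideal.span {α ⟨I, hI⟩} = Ideal.span {(a : 𝓞 K)} := by
      rw [← h2, hI0, mul_comm]
    rw [Ideal.span_singleton_eq_span_singleton] at h3
    obtain ⟨u, hu⟩ := h3
    refine ⟨(⟨I, hI⟩, u), Subtype.ext ?_⟩
    show (u : 𝓞 K) * α ⟨I, hI⟩ = a
    rw [← hu, mul_comm]
  have hmain : ∀ T : ℝ, 1 ≤ T → ∑' a : (J : Ideal (𝓞 K)), Φ ((1 / T) • mixedEmbedding K (a : 𝓞 K)) =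
      ∑' I : {I : (Ideal (𝓞 K))⁰ // ClassGroup.mk0 I = c},
        ((g (((Ideal.absNorm (I.1 : Ideal (𝓞 K)) : ℝ) * (Ideal.absNorm (J : Ideal (𝓞 K)) / T ^ n)) ^ 2) : ℝ) : ℂ) := by
    intro T hT
    have hsupp : (Function.support fun a : (J : Ideal (𝓞 K)) => Φ ((1 / T) • mixedEmbedding K (a : 𝓞 K))) ⊆ Set.range θ := by
      intro a ha
      apply hθr
      intro h0
      apply ha
      show Φ _ = 0
      rw [h0]
      apply hΦ0
      simp
    rw [← hθ.tsum_eq hsupp]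
    have hsum : Summable fun p => Φ ((1 / T) • mixedEmbedding K (θ p : 𝓞 K)) := by
      apply summable_of_hasFiniteSupport
      exact (hfin T hT).preimage hθ.injOn
    rw [hsum.tsum_prod]
    refine tsum_congr fun I => ?_
    have h1 : ∀ u : (𝓞 K)ˣ, (1 / T) • mixedEmbedding K (θ (I, u) : 𝓞 K) =
        u • ((1 / T) • mixedEmbedding K (α I : 𝓞 K)) := by
      intro u
      show (1 / T) • mixedEmbedding K (((u : 𝓞 K) * α I : 𝓞 K) : K) = _
      rw [unitSMul_smul, RingOfIntegers.coe_eq_algebraMap, map_mul, map_mul]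
      rw [mul_smul_comm]
    simp_rw [h1]
    have h2 : mixedEmbedding.norm ((1 / T) • mixedEmbedding K (α I : 𝓞 K)) =
        (Ideal.absNorm (I.1 : Ideal (𝓞 K)) : ℝ) * (Ideal.absNorm (J : Ideal (𝓞 K)) / T ^ n) := by
      rw [mixedEmbedding.norm_smul, mixedEmbedding.norm_eq_norm]
      have h3 : (Ideal.absNorm (I.1 : Ideal (𝓞 K)) : ℝ) * Ideal.absNorm (J : Ideal (𝓞 K)) =
          |(Algebra.norm ℚ ((α I : 𝓞 K) : K))| := by
        rw [← Nat.cast_mul, ← map_mul, hα, Ideal.absNorm_span_singleton, ← Algebra.coe_norm_int]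
        simp [Nat.cast_natAbs]
      rw [mul_div_assoc', h3, abs_of_pos (by positivity)]
      rw [one_div, inv_pow]
      ring
    have h0 : mixedEmbedding.norm ((1 / T) • mixedEmbedding K (α I : 𝓞 K)) ≠ 0 := by
      rw [h2]
      have : (Ideal.absNorm (I.1.1 : Ideal (𝓞 K)) : ℝ) ≠ 0 := by
        rw [Nat.cast_ne_zero, ne_eq, Ideal.absNorm_eq_zero_iff]
        exact nonZeroDivisors.coe_ne_zero _
      positivity
    rw [(hΦu _ h0).2, h2]
  obtain ⟨C, hC0, hC⟩ := hR n
  refine ⟨R * Ideal.absNorm (J : Ideal (𝓞 K)), C, hC0, ?_⟩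
  intro t ht ht1
  set A : ℝ := (Ideal.absNorm (J : Ideal (𝓞 K)) : ℝ) with hA
  have hAt : 1 ≤ A / t := by
    rw [le_div_iff₀ ht]; linarith
  let T : ℝ := (A / t) ^ (1 / n : ℝ)
  have hT : 1 ≤ T := Real.one_le_rpow hAt (by positivity)
  have hTn : T ^ n = A / t := by
    show ((A / t) ^ (1 / n : ℝ)) ^ n = A / t
    rw [one_div]
    exact Real.rpow_inv_natCast_pow (by positivity) hnpos
  have h := hC T hT
  rw [hmain T hT, ← Complex.ofReal_pow, hTn, one_div, inv_pow, hTn] at h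
  have e1 : A / (A / t) = t := by
    field_simp
  rw [e1] at h
  refine le_trans (le_of_eq ?_) (h.trans ?_)
  · congr 2
    push_cast
    rw [mul_div_assoc]
    rfl
  · rw [inv_div]
    apply mul_le_mul_of_nonneg_left _ hC0
    exact div_le_self ht.le hNJ
end stmtF3

section stmtH1
open MeasureTheory Set Complex Filter Topology

lemma stmtH_top {F : ℝ → ℂ} {M : ℝ} (h : ∀ t, M < t → F t = 0) (a : ℝ) : F =O[atTop] (· ^ (-a) : ℝ → ℝ) := by
  have : F =ᶠ[atTop] fun _ => (0 : ℂ) := by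
    filter_upwards [eventually_gt_atTop M] with t ht using h t ht
  exact this.trans_isBigO (Asymptotics.isBigO_zero _ _)

lemma stmtH_bot {F : ℝ → ℂ} {M : ℝ} {k : ℝ} (h : ∀ t, 0 < t → t ≤ 1 → ‖F t‖ ≤ M * t ^ k) :
    F =O[𝓝[>] 0] (· ^ (-(-k)) : ℝ → ℝ) := by
  refine Asymptotics.IsBigO.of_bound M ?_
  have : ∀ᶠ t : ℝ in 𝓝[>] 0, t ∈ Ioc (0:ℝ) 1 := Ioc_mem_nhdsGT one_pos
  filter_upwards [this] with t ht
  rw [neg_neg, Real.norm_of_nonneg (Real.rpow_nonneg ht.1.le _)]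
  exact h t ht.1 ht.2

/-- properties of the weight -/
structure stmtHW (f : ℝ → ℝ) : Prop where
  cont : Continuous f
  nonneg : ∀ t, 0 ≤ f t
  supp : ∀ t, 0 ≤ t → f t ≠ 0 → 1 < t ∧ t < 3 / 2
  one : ∀ t ∈ Ioo (1.12 : ℝ) 1.32, f t = 1

variable {f : ℝ → ℝ}

lemma stmtHW.locInt (hf : stmtHW f) : LocallyIntegrableOn (fun t => (f t : ℂ)) (Ioi 0) :=
  ((continuous_ofReal.comp hf.cont).locallyIntegrable).locallyIntegrableOn _

lemma stmtHW.top (hf : stmtHW f) (a : ℝ) : (fun t => (f t : ℂ)) =O[atTop] (· ^ (-a) : ℝ → ℝ) := by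
  refine stmtH_top (M := 3/2) (fun t ht => ?_) a
  have : f t = 0 := by
    by_contra hne
    have := (hf.supp t (by linarith) hne).2
    linarith
  simp [this]

lemma stmtHW.bot (hf : stmtHW f) (k : ℝ) : (fun t => (f t : ℂ)) =O[𝓝[>] 0] (· ^ (-(-k)) : ℝ → ℝ) := by
  refine stmtH_bot (M := 0) (fun t ht ht1 => ?_)
  have : f t = 0 := by
    by_contra hne
    have := (hf.supp t (by linarith) hne).1
    linarith
  simp [this]

lemma stmtHW.conv (hf : stmtHW f) (s : ℂ) : MellinConvergent (fun t => (f t : ℂ)) s :=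
  mellinConvergent_of_isBigO_rpow hf.locInt (hf.top (s.re + 1)) (by linarith)
    (hf.bot (-(s.re - 1))) (by linarith)

lemma stmtHW.diff (hf : stmtHW f) (s : ℂ) : DifferentiableAt ℂ (mellin (fun t => (f t : ℂ))) s :=
  mellin_differentiableAt_of_isBigO_rpow hf.locInt (hf.top (s.re + 1)) (by linarith)
    (hf.bot (-(s.re - 1))) (by linarith)

lemma stmtHW.ne (hf : stmtHW f) (s : ℂ) (hs : |s.im| < 3) : mellin (fun t => (f t : ℂ)) s ≠ 0 := by
  have hre : 0 < (mellin (fun t => (f t : ℂ)) s).re := by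
    have hinteg := hf.conv s
    unfold MellinConvergent at hinteg
    rw [mellin]
    have h1 : ((∫ t in Ioi (0:ℝ), (t : ℂ) ^ (s - 1) • (f t : ℂ)).re) =
        ∫ t in Ioi (0:ℝ), ((t : ℂ) ^ (s - 1) • (f t : ℂ)).re := by
      exact (reCLM.integral_comp_comm hinteg).symm
    rw [h1]
    have hval : ∀ t : ℝ, 0 < t → ((t : ℂ) ^ (s - 1) • (f t : ℂ)).re =
        Real.exp ((s.re - 1) * Real.log t) * Real.cos (s.im * Real.log t) * f t := by
      intro t ht
      rw [smul_eq_mul, cpow_def_of_ne_zero (by exact_mod_cast ht.ne'), ← ofReal_log ht.le,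
        re_mul_ofReal, exp_re]
      simp [mul_comm]
    have hcos : ∀ t : ℝ, 1 < t → t < 3 / 2 → 0 < Real.cos (s.im * Real.log t) := by
      intro t ht ht2
      have hl : 0 < Real.log t := Real.log_pos ht
      have hl2 : Real.log t < 1 / 2 := by
        have := Real.log_le_sub_one_of_pos (x := t) (by linarith)
        linarith
      have hab : |s.im * Real.log t| < Real.pi / 2 := by
        rw [abs_mul, abs_of_pos hl]
        have := Real.pi_gt_three
        nlinarith [abs_nonneg s.im]
      rw [abs_lt] at hab
      exact Real.cos_pos_of_mem_Ioo ⟨by linarith [hab.1], hab.2⟩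
    rw [setIntegral_pos_iff_support_of_nonneg_ae]
    · refine lt_of_lt_of_le ?_ (measure_mono (?_ : Ioo (1.12:ℝ) 1.32 ⊆ _))
      · simp
        norm_num
      · intro t ht
        have ht0 : 0 < t := by linarith [ht.1]
        refine ⟨?_, ht0⟩
        rw [Function.mem_support, hval t ht0, hf.one t ht, mul_one]
        exact (mul_pos (Real.exp_pos _) (hcos t (by linarith [ht.1]) (by linarith [ht.2]))).ne'
    · filter_upwards [ae_restrict_mem measurableSet_Ioi] with t ht
      rw [hval t ht]
      by_cases hft : f t = 0
      · simp [hft]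
      · have := hf.supp t (le_of_lt ht) hft
        exact mul_nonneg (mul_pos (Real.exp_pos _) (hcos t this.1 this.2)).le (hf.nonneg t)
    · exact hinteg.re
  intro h
  rw [h] at hre
  simp at hre
end stmtH1

section stmtH2
open MeasureTheory Set Complex Filter Topology
variable {f : ℝ → ℝ}

lemma stmtH_cont (hf : stmtHW f) (a : ℕ → ℂ) :
    ContinuousOn (fun t : ℝ => ∑' m : ℕ, a m * (f (m * t) : ℂ)) (Ioi 0) := by
  intro t0 ht0
  have ht0' : (0:ℝ) < t0 := ht0
  apply ContinuousAt.continuousWithinAt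
  obtain ⟨N, hN⟩ := exists_nat_gt (3 / t0)
  have hev : ∀ᶠ t in 𝓝 t0, t0 / 2 < t := eventually_gt_nhds (by linarith)
  have : (fun t : ℝ => ∑' m : ℕ, a m * (f (m * t) : ℂ)) =ᶠ[𝓝 t0]
      fun t => ∑ m ∈ Finset.range N, a m * (f (m * t) : ℂ) := by
    filter_upwards [hev] with t ht
    refine tsum_eq_sum fun m hm => ?_
    have hmN : (N : ℝ) ≤ m := by
      simp only [Finset.mem_range, not_lt] at hm
      exact_mod_cast hm
    have : f (m * t) = 0 := by
      by_contra hne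
      have h2 := (hf.supp (m * t) (by have : 0 < t := by linarith
                                      positivity) hne).2
      rw [div_lt_iff₀ ht0'] at hN
      nlinarith
    simp [this]
  refine ContinuousAt.congr ?_ this.symm
  apply Continuous.continuousAt
  have := hf.cont
  fun_prop

lemma stmtH_mellinB (hf : stmtHW f) (a : ℕ → ℂ) (s : ℂ) (hs : LSeriesSummable a s) :
    mellin (fun t : ℝ => ∑' m : ℕ, a m * (f (m * t) : ℂ)) s = LSeries a s * mellin (fun t => (f t : ℂ)) s := by
  have hf0 : f 0 = 0 := by
    by_contra hne
    have := (hf.supp 0 le_rfl hne).1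
    linarith
  have hterm : ∀ m : ℕ, mellin (fun t : ℝ => a m * (f (m * t) : ℂ)) s =
      LSeries.term a s m * mellin (fun t => (f t : ℂ)) s := by
    intro m
    rcases Nat.eq_zero_or_pos m with rfl | hm
    · simp [mellin, hf0]
    · have h1 := mellin_comp_mul_left (fun t => (f t : ℂ)) s (a := (m : ℝ)) (by exact_mod_cast hm)
      have h2 : mellin (fun t : ℝ => a m * (f (m * t) : ℂ)) s = a m * mellin (fun t : ℝ => (f (m * t) : ℂ)) s := by
        have := mellin_const_smul (fun t : ℝ => (f (m * t) : ℂ)) s (a m)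
        simpa using this
      rw [h2, h1, LSeries.term_of_ne_zero hm.ne']
      rw [smul_eq_mul, cpow_neg, ofReal_natCast]
      ring
  have hconv : ∀ m : ℕ, IntegrableOn (fun t : ℝ => (t : ℂ) ^ (s - 1) • (a m * (f (m * t) : ℂ))) (Ioi 0) := by
    intro m
    rcases Nat.eq_zero_or_pos m with rfl | hm
    · simp [hf0]
    · have h1 := (MellinConvergent.comp_mul_left (f := fun t => (f t : ℂ)) (s := s) (a := (m : ℝ))
        (by exact_mod_cast hm)).2 (hf.conv s)
      have := h1.const_smul (a m)
      simpa [MellinConvergent] using this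
  have hnorm : ∀ m : ℕ, ∫ t in Ioi (0:ℝ), ‖(t : ℂ) ^ (s - 1) • (a m * (f (m * t) : ℂ))‖ =
      ‖LSeries.term a s m‖ * ∫ t in Ioi (0:ℝ), t ^ (s.re - 1) * f t := by
    intro m
    rcases Nat.eq_zero_or_pos m with rfl | hm
    · simp [hf0]
    · have hm' : (0:ℝ) < m := by exact_mod_cast hm
      rw [LSeries.norm_term_eq, if_neg hm.ne']
      have h1 : ∫ t in Ioi (0:ℝ), ‖(t : ℂ) ^ (s - 1) • (a m * (f (m * t) : ℂ))‖ =
          ∫ t in Ioi (0:ℝ), (‖a m‖ * (m:ℝ) ^ (1 - s.re)) * ((fun x => x ^ (s.re - 1) * f x) (m * t)) := by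
        refine setIntegral_congr_fun measurableSet_Ioi fun t ht => ?_
        have ht' : (0:ℝ) < t := ht
        simp only [smul_eq_mul, norm_mul]
        rw [norm_cpow_eq_rpow_re_of_pos ht', norm_real, Real.norm_of_nonneg (hf.nonneg _),
          Real.mul_rpow hm'.le ht'.le]
        have e : (m:ℝ) ^ (1 - s.re) * (m:ℝ) ^ (s.re - 1) = 1 := by
          rw [← Real.rpow_add hm']; simp
        simp only [sub_re, one_re]
        calc _ = ((m:ℝ) ^ (1 - s.re) * (m:ℝ) ^ (s.re - 1)) * (t ^ (s.re - 1) * (‖a m‖ * f (m * t))) := by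
              rw [e, one_mul]
          _ = _ := by ring
      rw [h1, integral_const_mul, integral_comp_mul_left_Ioi (fun x => x ^ (s.re - 1) * f x) 0 hm', mul_zero,
        smul_eq_mul]
      have e : (m:ℝ) ^ (1 - s.re) * (m:ℝ)⁻¹ = ((m:ℝ) ^ s.re)⁻¹ := by
        rw [← Real.rpow_neg_one, ← Real.rpow_add hm', ← Real.rpow_neg hm'.le]
        congr 1; ring
      rw [div_eq_mul_inv, ← e]
      ring
  have hsum : Summable fun m : ℕ => ∫ t in Ioi (0:ℝ), ‖(t : ℂ) ^ (s - 1) • (a m * (f (m * t) : ℂ))‖ := by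
    simp_rw [hnorm]
    exact hs.norm.mul_right _
  have h := hasSum_integral_of_summable_integral_norm hconv hsum
  have h2 : ∑' m, mellin (fun t : ℝ => a m * (f (m * t) : ℂ)) s = _ := h.tsum_eq
  simp_rw [hterm] at h2
  rw [tsum_mul_right] at h2
  rw [LSeries, h2, mellin]
  refine setIntegral_congr_fun measurableSet_Ioi fun t ht => ?_
  simp only [smul_eq_mul]
  rw [tsum_mul_left]

lemma stmtH_main (hf : stmtHW f) (a : ℕ → ℂ) (hs : ∀ s : ℂ, 1 < s.re → LSeriesSummable a s) (R : ℂ) (M : ℝ)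
    (h : ∀ t : ℝ, 0 < t → t ≤ 1 → ‖∑' m : ℕ, a m * (f (m * t) : ℂ) - R / t‖ ≤ M * t) :
    ∃ Z : ℂ → ℂ, DifferentiableOn ℂ Z {s | -1 < s.re ∧ |s.im| < 3} ∧
      ∀ s : ℂ, 1 < s.re → |s.im| < 3 → Z s = (s - 1) * LSeries a s := by
  set B : ℝ → ℂ := fun t : ℝ => ∑' m : ℕ, a m * (f (m * t) : ℂ) with hB
  set I1 : ℝ → ℂ := indicator (Ioc 0 1) (fun t => (t : ℂ) ^ (-1 : ℂ)) with hI1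
  let E : ℝ → ℂ := fun t => B t - R • I1 t
  have hBtop : ∀ t, 3 / 2 < t → B t = 0 := by
    intro t ht
    rw [hB]
    convert tsum_zero with m
    have : f (m * t) = 0 := by
      by_contra hne
      have h1 := hf.supp (m * t) (by positivity) hne
      rcases Nat.eq_zero_or_pos m with rfl | hm
      · have := h1.1; simp at this; linarith
      · have : (1:ℝ) ≤ m := by exact_mod_cast hm
        nlinarith
    simp [this]
  have hBint : LocallyIntegrableOn B (Ioi 0) := (stmtH_cont hf a).locallyIntegrableOn measurableSet_Ioi
  have hIint : LocallyIntegrableOn I1 (Ioi 0) := by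
    rw [locallyIntegrableOn_iff isOpen_Ioi.isLocallyClosed]
    intro k hk hkc
    apply IntegrableOn.indicator _ measurableSet_Ioc
    apply ContinuousOn.integrableOn_compact hkc
    intro t ht
    have : (0:ℝ) < t := hk ht
    apply ContinuousAt.continuousWithinAt
    exact continuousAt_ofReal_cpow_const _ _ (Or.inr this.ne')
  have hEint : LocallyIntegrableOn E (Ioi 0) := hBint.sub (hIint.smul R)
  have hEtop : ∀ t, 3 / 2 < t → E t = 0 := by
    intro t ht
    have : I1 t = 0 := indicator_of_notMem (fun hh => by linarith [hh.2]) _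
    simp [E, hBtop t ht, this]
  have hEbot : ∀ t : ℝ, 0 < t → t ≤ 1 → ‖E t‖ ≤ M * t ^ (1:ℝ) := by
    intro t ht ht1
    have : I1 t = (t : ℂ)⁻¹ := by
      have hmem : t ∈ Ioc (0:ℝ) 1 := ⟨ht, ht1⟩
      rw [hI1, indicator_of_mem hmem, cpow_neg_one]
    rw [Real.rpow_one]
    simp only [E, this, smul_eq_mul, ← div_eq_mul_inv]
    exact h t ht ht1
  have hEconv : ∀ s : ℂ, -1 < s.re → MellinConvergent E s := fun s hs =>
    mellinConvergent_of_isBigO_rpow hEint (stmtH_top hEtop (s.re + 1)) (by linarith)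
      (stmtH_bot hEbot) (by linarith)
  have hEdiff : ∀ s : ℂ, -1 < s.re → DifferentiableAt ℂ (mellin E) s := fun s hs =>
    mellin_differentiableAt_of_isBigO_rpow hEint (stmtH_top hEtop (s.re + 1)) (by linarith)
      (stmtH_bot hEbot) (by linarith)
  refine ⟨fun s => ((s - 1) * mellin E s + R) / mellin (fun t => (f t : ℂ)) s, ?_, ?_⟩
  · intro s hs
    apply DifferentiableAt.differentiableWithinAt
    have h1 := hEdiff s hs.1
    have h2 := hf.diff s
    have h3 := hf.ne s hs.2
    fun_prop (disch := assumption)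
  · intro s hs1 hs2
    have h3 := hf.ne s hs2
    simp only
    rw [div_eq_iff h3, mul_assoc, ← stmtH_mellinB hf a s (hs s hs1)]
    have hI := hasMellin_cpow_Ioc (-1) (s := s) (by simp; linarith)
    have hI2 := hasMellin_const_smul hI.1 R
    have hsum := hasMellin_add (hEconv s (by linarith)) hI2.1
    have e : (fun t => E t + R • I1 t) = B := by
      funext t; simp [E]
    have h4 := hsum.2
    rw [hI2.2, hI.2] at h4
    have h5 : mellin B s = mellin E s + R • (1 / (s + -1)) := by
      rw [← h4, ← e]
    change _ = (s - 1) * mellin B s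
    have hs0 : s - 1 ≠ 0 := by
      intro h0
      have : s = 1 := sub_eq_zero.mp h0
      rw [this] at hs1
      simp at hs1
    rw [h5, ← sub_eq_add_neg, smul_eq_mul]
    field_simp
end stmtH2

section stmtG1
open NumberField Filter Topology
open scoped Classical nonZeroDivisors

abbrev stmtX (K : Type*) [Field K] [NumberField K] := ↥((Ideal (𝓞 K))⁰)

variable {K : Type*} [Field K] [NumberField K]

noncomputable def stmtN (I : stmtX K) : ℕ := Ideal.absNorm (I : Ideal (𝓞 K))

lemma stmtN_pos (I : stmtX K) : 0 < stmtN I := Ideal.absNorm_pos_of_nonZeroDivisors I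

lemma stmtN_one_le (I : stmtX K) : (1 : ℝ) ≤ stmtN I := by exact_mod_cast stmtN_pos I

lemma stmtN_mul (I J : stmtX K) : stmtN (I * J) = stmtN I * stmtN J := by
  simp [stmtN]

lemma stmtN_finite (n : ℕ) : {I : stmtX K | stmtN I ≤ n}.Finite := Ideal.finite_setOfPred_absNorm_le₀ n

lemma stmtN_finite_eq (m : ℕ) : {I : stmtX K | stmtN I = m}.Finite := by
  refine (stmtN_finite m).subset ?_
  intro I hI
  exact le_of_eq hI

noncomputable def stmtFib (m : ℕ) : Finset (stmtX K) := (stmtN_finite_eq m).toFinset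

lemma stmtFib_mem {m : ℕ} {I : stmtX K} : I ∈ stmtFib m ↔ stmtN I = m := by
  rw [stmtFib, Set.Finite.mem_toFinset, Set.mem_ofPred_eq]

noncomputable def stmtA (w : stmtX K → ℂ) (m : ℕ) : ℂ := ∑ I ∈ stmtFib m, w I

lemma stmtG_hasSum {w : stmtX K → ℂ} {h : ℕ → ℂ} (hs : Summable fun I => w I * h (stmtN I)) :
    HasSum (fun m => stmtA w m * h m) (∑' I, w I * h (stmtN I)) := by
  have := hs.hasSum.tsum_fiberwise stmtN
  refine this.congr_fun ?_ |> fun h => h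
  intro m
  have e : (stmtN ⁻¹' {m} : Set (stmtX K)) = ↑(stmtFib (K := K) m) := by
    ext I; simp [stmtFib_mem]
  rw [stmtA, Finset.sum_mul]
  rw [tsum_congr_set_coe (fun I => w I * h (stmtN I)) e, Finset.tsum_subtype' (stmtFib m) (fun I => w I * h (stmtN I))]
  refine Finset.sum_congr rfl fun I hI => ?_
  rw [stmtFib_mem.1 hI]

noncomputable def stmtCnt (c : ClassGroup (𝓞 K)) (m : ℕ) : ℝ :=
  ((stmtFib m).filter fun I => ClassGroup.mk0 I = c).card

noncomputable def stmtKappa (K : Type*) [Field K] [NumberField K] : ℝ :=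
  (2 ^ InfinitePlace.nrRealPlaces K * (2 * Real.pi) ^ InfinitePlace.nrComplexPlaces K * Units.regulator K) /
            (Units.torsionOrder K * Real.sqrt |discr K|)

lemma stmtKappa_pos : 0 < stmtKappa K := by
  refine div_pos ?_ ?_
  · exact mul_pos (by positivity) (Units.regulator_pos K)
  · exact mul_pos (Nat.cast_pos.mpr (Units.torsionOrder_pos K)) <|
      Real.sqrt_pos_of_pos <| abs_pos.mpr (Int.cast_ne_zero.mpr (discr_ne_zero K))

lemma stmtG_cnt (c : ClassGroup (𝓞 K)) :
    Tendsto (fun n : ℕ => (∑ k ∈ Finset.Icc 1 n, stmtCnt c k) / (n : ℝ)) atTop (𝓝 (stmtKappa K)) := by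
  have h := (NumberField.Ideal.tendsto_norm_le_and_mk_eq_div_atTop K c).comp tendsto_natCast_atTop_atTop
  refine h.congr fun n => ?_
  simp only [Function.comp_apply, Nat.cast_le]
  congr 1
  simp only [stmtCnt]
  rw [← Nat.cast_sum]
  congr 1
  have hd : ∀ i ∈ Finset.Icc 1 n, ∀ j ∈ Finset.Icc 1 n, i ≠ j →
      Disjoint ((stmtFib (K := K) i).filter fun I => ClassGroup.mk0 I = c)
        ((stmtFib (K := K) j).filter fun I => ClassGroup.mk0 I = c) := by
    intro i _ j _ hij
    rw [Finset.disjoint_left]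
    intro I hI hJ
    simp only [Finset.mem_filter, stmtFib_mem] at hI hJ
    exact hij (hI.1.symm.trans hJ.1)
  rw [← Finset.card_biUnion hd]
  rw [← Nat.card_eq_finsetCard]
  refine Nat.card_congr (Equiv.subtypeEquivRight fun I => ?_)
  simp only [Finset.mem_biUnion, Finset.mem_Icc, Finset.mem_filter, stmtFib_mem]
  constructor
  · rintro ⟨h1, h2⟩
    exact ⟨_, ⟨stmtN_pos I, h1⟩, rfl, h2⟩
  · rintro ⟨i, ⟨_, h1⟩, h2, h3⟩
    exact ⟨by rw [← h2] at h1; exact h1, h3⟩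

lemma stmtG_cnt_summable (c : ClassGroup (𝓞 K)) (s : ℂ) (hs : 1 < s.re) :
    LSeriesSummable (fun n => (stmtCnt c n : ℂ)) s := by
  refine LSeriesSummable_of_sum_norm_bigO_and_nonneg ?_ (fun n => Nat.cast_nonneg _) zero_le_one hs
  exact Asymptotics.isBigO_atTop_natCast_rpow_of_tendsto_div_rpow (by simpa using stmtG_cnt c)

lemma stmtG_cnt_tendsto (c : ClassGroup (𝓞 K)) :
    Tendsto (fun s : ℝ => (s - 1) * LSeries (fun n => (stmtCnt c n : ℂ)) s) (𝓝[>] 1) (𝓝 (stmtKappa K : ℂ)) :=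
  LSeries_tendsto_sub_mul_nhds_one_of_tendsto_sum_div_and_nonneg _ (stmtG_cnt c) (fun n => Nat.cast_nonneg _)

lemma stmtG_cnt_A (c : ClassGroup (𝓞 K)) (m : ℕ) :
    stmtA (fun I : stmtX K => if ClassGroup.mk0 I = c then 1 else 0) m = stmtCnt c m := by
  simp [stmtA, stmtCnt, Finset.sum_boole]

lemma stmtG_norm_summable (σ : ℝ) (hσ : 1 < σ) : Summable fun I : stmtX K => (stmtN I : ℝ) ^ (-σ) := by
  rw [← (Equiv.sigmaFiberEquiv (stmtN (K := K))).summable_iff]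
  refine (summable_sigma_of_nonneg (fun _ => Real.rpow_nonneg (Nat.cast_nonneg _) _)).2 ?_
  have hfin : ∀ m, Finite {I : stmtX K // stmtN I = m} := fun m =>
    (stmtN_finite_eq m).to_subtype
  constructor
  · intro m
    have := hfin m
    exact Summable.of_finite
  · have h1 : Summable fun m : ℕ => ∑ c : ClassGroup (𝓞 K), ‖LSeries.term (fun n => (stmtCnt c n : ℂ)) (σ : ℂ) m‖ :=
      summable_sum fun c _ => (stmtG_cnt_summable c σ (by simpa using hσ)).norm
    refine h1.congr fun m => ?_
    have := Fintype.ofFinite {I : stmtX K // stmtN I = m}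
    rw [tsum_fintype]
    have h2 : ∀ I : {I : stmtX K // stmtN I = m}, (stmtN ((Equiv.sigmaFiberEquiv (stmtN (K := K))) ⟨m, I⟩) : ℝ) ^ (-σ) = (m : ℝ) ^ (-σ) := by
      intro I
      show ((stmtN I.1 : ℝ)) ^ (-σ) = _
      rw [I.2]
    rw [Finset.sum_congr rfl fun I _ => h2 I, Finset.sum_const, nsmul_eq_mul]
    have h3 : ∀ c : ClassGroup (𝓞 K), ‖LSeries.term (fun n => (stmtCnt c n : ℂ)) (σ : ℂ) m‖ = stmtCnt c m * (m:ℝ) ^ (-σ) := by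
      intro c
      rw [LSeries.norm_term_eq]
      rcases Nat.eq_zero_or_pos m with rfl | hm
      · have : stmtFib (K := K) 0 = ∅ := by
          ext I
          simp [stmtFib_mem, (stmtN_pos I).ne']
        simp [stmtCnt, this]
      · rw [if_neg hm.ne', Complex.norm_real, Real.norm_of_nonneg (show 0 ≤ stmtCnt c m from Nat.cast_nonneg _), Complex.ofReal_re,
          Real.rpow_neg (Nat.cast_nonneg _)]
        rfl
    rw [Finset.sum_congr rfl fun c _ => h3 c, ← Finset.sum_mul]
    congr 1
    simp only [stmtCnt]
    rw [← Nat.cast_sum]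
    congr 1
    rw [← Finset.card_eq_sum_card_fiberwise (f := fun I => ClassGroup.mk0 I) (t := Finset.univ) (fun _ _ => by simp)]
    rw [Finset.card_univ, ← Nat.card_eq_fintype_card, ← Nat.card_eq_finsetCard]
    exact Nat.card_congr (Equiv.subtypeEquivRight fun I => by rw [stmtFib_mem])

lemma stmtG_w_summable {w : stmtX K → ℂ} (hw : ∀ I, ‖w I‖ ≤ Real.log (stmtN I) + 1) (s : ℂ) (hs : 1 < s.re) :
    Summable fun I : stmtX K => w I * (stmtN I : ℂ) ^ (-s) := by
  obtain ⟨δ, hδ, hδ2⟩ : ∃ δ : ℝ, 0 < δ ∧ 1 < s.re - δ := ⟨(s.re - 1) / 2, by linarith, by linarith⟩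
  have h1 := (stmtG_norm_summable (K := K) _ hδ2).mul_left (1 / δ + 1)
  refine Summable.of_norm_bounded h1 fun I => ?_
  have hN := stmtN_one_le I
  have hN0 : (0:ℝ) < stmtN I := by linarith
  rw [norm_mul, Complex.norm_natCast_cpow_of_pos (stmtN_pos I), Complex.neg_re]
  have h2 : Real.log (stmtN I) ≤ (stmtN I : ℝ) ^ δ / δ := Real.log_le_rpow_div hN0.le hδ
  have h3 : (1:ℝ) ≤ (stmtN I : ℝ) ^ δ := Real.one_le_rpow hN hδ.le
  have h4 : ‖w I‖ ≤ (1 / δ + 1) * (stmtN I : ℝ) ^ δ := by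
    have := hw I
    have e : (1 / δ + 1) * (stmtN I : ℝ) ^ δ = (stmtN I : ℝ) ^ δ / δ + (stmtN I : ℝ) ^ δ := by ring
    rw [e]; linarith
  calc _ ≤ ((1 / δ + 1) * (stmtN I : ℝ) ^ δ) * (stmtN I : ℝ) ^ (-s.re) := by
        gcongr
    _ = _ := by
        rw [mul_assoc, ← Real.rpow_add hN0]
        congr 2; ring

lemma stmtG_term (w : stmtX K → ℂ) (s : ℂ) (m : ℕ) :
    LSeries.term (stmtA w) s m = stmtA w m * (m : ℂ) ^ (-s) := by
  rcases Nat.eq_zero_or_pos m with rfl | hm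
  · have : stmtFib (K := K) 0 = ∅ := by
      ext I
      simp [stmtFib_mem, (stmtN_pos I).ne']
    simp [stmtA, this]
  · rw [LSeries.term_of_ne_zero hm.ne', Complex.cpow_neg, div_eq_mul_inv]

lemma stmtG_LSeries {w : stmtX K → ℂ} {s : ℂ} (h : Summable fun I : stmtX K => w I * (stmtN I : ℂ) ^ (-s)) :
    LSeriesHasSum (stmtA w) s (∑' I : stmtX K, w I * (stmtN I : ℂ) ^ (-s)) := by
  have := stmtG_hasSum (h := fun m => (m : ℂ) ^ (-s)) h
  rw [LSeriesHasSum]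
  simpa only [funext (stmtG_term w s)] using this
end stmtG1

section stmtG2
open NumberField Filter Topology
open scoped Classical nonZeroDivisors ContDiff

lemma stmtG_bump : ∃ g : ℝ → ℝ, ContDiff ℝ ∞ g ∧ (∀ y, g y ≠ 0 → 1 < y ∧ y < 2) ∧ stmtHW (fun t => g (t ^ 2)) := by
  let b : ContDiffBump (3 / 2 : ℝ) := ⟨1 / 4, 1 / 2, by norm_num, by norm_num⟩
  have hsupp : ∀ y, b y ≠ 0 → 1 < y ∧ y < 2 := by
    intro y hy
    have : y ∈ Function.support b := hy
    rw [b.support_eq, Metric.mem_ball, Real.dist_eq, abs_lt] at this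
    change -(1/2 : ℝ) < _ ∧ _ < (1/2 : ℝ) at this
    constructor <;> linarith [this.1, this.2]
  refine ⟨b, b.contDiff, hsupp, ?_, ?_, ?_, ?_⟩
  · exact b.continuous.comp (continuous_pow 2)
  · intro t; exact b.nonneg
  · intro t ht h
    have := hsupp _ h
    constructor <;> nlinarith [this.1, this.2]
  · intro t ht
    apply b.one_of_mem_closedBall
    rw [Metric.mem_closedBall, Real.dist_eq, abs_le]
    change -(1/4 : ℝ) ≤ _ ∧ _ ≤ (1/4 : ℝ)
    have h1 := ht.1
    have h2 := ht.2
    norm_num at h1 h2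
    constructor <;> nlinarith

variable {K : Type*} [Field K] [NumberField K]

lemma stmtG_Z (c : ClassGroup (𝓞 K)) : ∃ Z : ℂ → ℂ, DifferentiableOn ℂ Z {s | -1 < s.re ∧ |s.im| < 3} ∧
    (∀ s : ℂ, 1 < s.re → |s.im| < 3 → Z s = (s - 1) * LSeries (fun n => (stmtCnt c n : ℂ)) s) ∧
    Z 1 = stmtKappa K := by
  obtain ⟨g, hg, hg1, hW⟩ := stmtG_bump
  obtain ⟨R, M, hM, h⟩ := stmtF_classSum (K := K) c g hg hg1
  obtain ⟨Z, hZ, hZ2⟩ := stmtH_main hW (fun n => (stmtCnt c n : ℂ)) (fun s hs => stmtG_cnt_summable c s hs) R M (by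
    intro t ht ht1
    convert h t ht ht1 using 3
    have hs : Summable fun I : stmtX K => (if ClassGroup.mk0 I = c then (1:ℂ) else 0) * ((g ((stmtN I * t) ^ 2) : ℝ) : ℂ) := by
      apply summable_of_hasFiniteSupport
      refine (stmtN_finite (K := K) ⌈2 / t⌉₊).subset ?_
      intro I hI
      have h1 : g ((stmtN I * t) ^ 2) ≠ 0 := by
        intro h0
        apply hI
        simp [h0]
      have h2 := (hg1 _ h1).2
      have h3 : (stmtN I : ℝ) * t < 2 := by
        have : 0 ≤ (stmtN I : ℝ) * t := by positivity
        nlinarith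
      show stmtN I ≤ _
      have h4 : (stmtN I : ℝ) ≤ 2 / t := by rw [le_div_iff₀ ht]; exact h3.le
      exact_mod_cast h4.trans (Nat.le_ceil _)
    have h1 := (stmtG_hasSum (h := fun m => ((g ((m * t) ^ 2) : ℝ) : ℂ)) hs).tsum_eq
    simp only [stmtG_cnt_A] at h1
    rw [h1]
    rw [show (∑' I : {I : (Ideal (𝓞 K))⁰ // ClassGroup.mk0 I = c}, ((g (((Ideal.absNorm (I.1 : Ideal (𝓞 K)) : ℝ) * t) ^ 2) : ℝ) : ℂ)) = ∑' I : {I : stmtX K | ClassGroup.mk0 I = c}, (fun I : stmtX K => ((g ((stmtN I * t) ^ 2) : ℝ) : ℂ)) I from rfl]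
    rw [tsum_subtype (s := {I : stmtX K | ClassGroup.mk0 I = c}) (f := fun I : stmtX K => ((g ((stmtN I * t) ^ 2) : ℝ) : ℂ))]
    refine tsum_congr fun I => ?_
    by_cases hI : ClassGroup.mk0 I = c
    · rw [Set.indicator_of_mem (show I ∈ {I : stmtX K | ClassGroup.mk0 I = c} from hI), if_pos hI, one_mul]
    · rw [Set.indicator_of_notMem (show I ∉ {I : stmtX K | ClassGroup.mk0 I = c} from hI), if_neg hI, zero_mul])
  refine ⟨Z, hZ, hZ2, ?_⟩
  have hcont : ContinuousAt Z 1 := by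
    refine (hZ.differentiableAt ?_).continuousAt
    have ho : IsOpen {s : ℂ | -1 < s.re ∧ |s.im| < 3} :=
      (isOpen_lt continuous_const Complex.continuous_re).inter (isOpen_lt (continuous_abs.comp Complex.continuous_im) continuous_const)
    refine ho.mem_nhds ?_
    simp [Set.mem_ofPred_eq]
  have h1 : Tendsto (fun s : ℝ => Z s) (𝓝[>] 1) (𝓝 (Z 1)) := by
    have : Tendsto (fun s : ℝ => (s : ℂ)) (𝓝[>] 1) (𝓝 1) := by
      have := (Complex.continuous_ofReal.tendsto 1).mono_left (nhdsWithin_le_nhds (s := Set.Ioi 1))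
      simpa using this
    exact hcont.tendsto.comp this
  have h2 := stmtG_cnt_tendsto (K := K) c
  refine tendsto_nhds_unique (h1.congr' ?_) h2
  filter_upwards [self_mem_nhdsWithin] with s hs
  exact hZ2 s (by simpa using hs) (by simp)
end stmtG2

section stmtG3
open NumberField Filter Topology IsDedekindDomain
open scoped Classical nonZeroDivisors

abbrev stmtP (K : Type*) [Field K] [NumberField K] := HeightOneSpectrum (𝓞 K)

variable {K : Type*} [Field K] [NumberField K]

noncomputable def stmtPi (p : stmtP K) : stmtX K := ⟨p.asIdeal, mem_nonZeroDivisors_of_ne_zero p.ne_bot⟩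

lemma stmtPi_coe (p : stmtP K) : ((stmtPi p : stmtX K) : Ideal (𝓞 K)) = p.asIdeal := rfl

lemma stmtPi_two_le (p : stmtP K) : 2 ≤ stmtN (stmtPi p) := by
  have h1 := stmtN_pos (stmtPi p)
  have h2 : stmtN (stmtPi p) ≠ 1 := by
    intro h
    rw [stmtN, Ideal.absNorm_eq_one_iff] at h
    exact p.isPrime.ne_top h
  omega

lemma stmtN_pow (I : stmtX K) (k : ℕ) : stmtN (I ^ k) = stmtN I ^ k := by
  simp [stmtN]

noncomputable def stmtLg (I : stmtX K) : ℝ := Real.log (stmtN I)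

lemma stmtLg_nonneg (I : stmtX K) : 0 ≤ stmtLg I := Real.log_nonneg (stmtN_one_le I)

lemma stmtLg_Pi_pos (p : stmtP K) : 0 < stmtLg (stmtPi p) :=
  Real.log_pos (by exact_mod_cast (stmtPi_two_le p))

lemma stmtLg_mul (I J : stmtX K) : stmtLg (I * J) = stmtLg I + stmtLg J := by
  rw [stmtLg, stmtN_mul, Nat.cast_mul, Real.log_mul]; rfl
  · exact_mod_cast (stmtN_pos I).ne'
  · exact_mod_cast (stmtN_pos J).ne'

lemma stmtLg_pow (I : stmtX K) (k : ℕ) : stmtLg (I ^ k) = k * stmtLg I := by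
  rw [stmtLg, stmtN_pow, Nat.cast_pow, Real.log_pow]; rfl

noncomputable def stmtCt (p : stmtP K) (I : stmtX K) : ℕ :=
  (Associates.mk p.asIdeal).count (Associates.mk (I : Ideal (𝓞 K))).factors

lemma stmtCt_iff (p : stmtP K) (I : stmtX K) (k : ℕ) : k ≤ stmtCt p I ↔ stmtPi p ^ k ∣ I := by
  have h1 := Associates.prime_pow_dvd_iff_le (m := Associates.mk (I : Ideal (𝓞 K))) (p := Associates.mk p.asIdeal) (k := k)
    (Associates.mk_ne_zero.2 (nonZeroDivisors.coe_ne_zero I)) p.associates_irreducible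
  rw [stmtCt, ← h1, ← Associates.mk_pow, Associates.mk_le_mk_iff_dvd]
  constructor
  · rintro ⟨J, hJ⟩
    have hJ0 : J ≠ 0 := by
      rintro rfl
      exact nonZeroDivisors.coe_ne_zero I (by rw [hJ]; simp)
    exact ⟨⟨J, mem_nonZeroDivisors_of_ne_zero hJ0⟩, Subtype.ext hJ⟩
  · rintro ⟨J, rfl⟩
    exact ⟨J, rfl⟩

lemma stmtLg_prod (s : Finset (stmtP K)) (e : stmtP K → ℕ) :
    Real.log (Ideal.absNorm (∏ p ∈ s, p.asIdeal ^ e p) : ℕ) = ∑ p ∈ s, e p * stmtLg (stmtPi p) := by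
  rw [map_prod, Nat.cast_prod, Real.log_prod]
  · refine Finset.sum_congr rfl fun p _ => ?_
    rw [map_pow, Nat.cast_pow, Real.log_pow]; rfl
  · intro p _
    rw [map_pow, Nat.cast_pow]
    exact pow_ne_zero _ (by exact_mod_cast (stmtN_pos (stmtPi p)).ne')

lemma stmtP_log (I : stmtX K) : HasSum (fun p : stmtP K => stmtCt p I * stmtLg (stmtPi p)) (stmtLg I) := by
  have hI := nonZeroDivisors.coe_ne_zero I
  let T := (Ideal.hasFiniteMulSupport (R := 𝓞 K) hI).toFinset
  have h1 := Ideal.finprod_heightOneSpectrum_factorization (R := 𝓞 K) hI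
  rw [finprod_eq_prod_of_mulSupport_subset (s := T) _ (by intro p hp; exact Finset.mem_coe.2 ((Set.Finite.mem_toFinset _).2 hp))] at h1
  have h2 : stmtLg I = ∑ p ∈ T, stmtCt p I * stmtLg (stmtPi p) := by
    rw [← stmtLg_prod, stmtLg, stmtN]
    conv_lhs => rw [← h1]
    rfl
  rw [h2]
  refine hasSum_sum_of_ne_finset_zero fun p hp => ?_
  have h3 : p.maxPowDividing (I : Ideal (𝓞 K)) = 1 := by
    by_contra h
    exact hp ((Set.Finite.mem_toFinset _).2 h)
  have h4 : stmtLg (stmtPi p ^ stmtCt p I) = 0 := by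
    have : (stmtPi p ^ stmtCt p I : stmtX K) = 1 := Subtype.ext h3
    rw [this]; simp [stmtLg, stmtN]
  rw [← stmtLg_pow, h4]

abbrev stmtQ (K : Type*) [Field K] [NumberField K] := stmtP K × ℕ

noncomputable def stmtPw (q : stmtQ K) : stmtX K := stmtPi q.1 ^ (q.2 + 1)

lemma stmtPw_inj : Function.Injective (stmtPw (K := K)) := by
  rintro ⟨p, k⟩ ⟨q, l⟩ h
  have h1 : p.asIdeal ^ (k + 1) = q.asIdeal ^ (l + 1) := congrArg Subtype.val h
  have h2 : p = q := by
    apply HeightOneSpectrum.ext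
    have h3 : p.asIdeal ∣ q.asIdeal ^ (l + 1) := h1 ▸ dvd_pow_self _ (Nat.succ_ne_zero k)
    have h4 : p.asIdeal ∣ q.asIdeal := p.prime.dvd_of_dvd_pow h3
    have := p.prime.associated_of_dvd q.prime h4
    exact associated_iff_eq.1 this
  subst h2
  have h3 := congrArg stmtN h
  simp only [stmtPw, stmtN_pow] at h3
  have := Nat.pow_right_injective (stmtPi_two_le p) h3
  simp at this
  rw [this]

lemma stmtQ_log (I : stmtX K) : HasSum (fun q : stmtQ K => if stmtPw q ∣ I then stmtLg (stmtPi q.1) else 0) (stmtLg I) := by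
  have h1 := stmtP_log I
  have hk : ∀ p : stmtP K, HasSum (fun k : ℕ => if stmtPw (p, k) ∣ I then stmtLg (stmtPi p) else 0) (stmtCt p I * stmtLg (stmtPi p)) := by
    intro p
    have : stmtCt p I * stmtLg (stmtPi p) = ∑ k ∈ Finset.range (stmtCt p I), (if stmtPw (p, k) ∣ I then stmtLg (stmtPi p) else 0) := by
      rw [Finset.sum_congr rfl (g := fun _ => stmtLg (stmtPi p)), Finset.sum_const, Finset.card_range, nsmul_eq_mul]
      intro k hk
      rw [if_pos]
      exact (stmtCt_iff p I (k+1)).1 (Finset.mem_range.1 hk)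
    rw [this]
    refine hasSum_sum_of_ne_finset_zero fun k hk => ?_
    rw [if_neg]
    intro h
    exact hk (Finset.mem_range.2 ((stmtCt_iff p I (k+1)).2 h))
  have hs : Summable (fun q : stmtQ K => if stmtPw q ∣ I then stmtLg (stmtPi q.1) else 0) := by
    refine (summable_prod_of_nonneg ?_).2 ⟨fun p => (hk p).summable, ?_⟩
    · intro q
      dsimp
      split_ifs
      · exact stmtLg_nonneg _
      · exact le_rfl
    · simp only [fun p => (hk p).tsum_eq]
      exact h1.summable
  have := hs.hasSum.prod_fiberwise hk
  have e := this.unique h1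
  rw [← e]
  exact hs.hasSum
end stmtG3

section stmtG4
open NumberField Filter Topology IsDedekindDomain
open scoped Classical nonZeroDivisors

variable {K : Type*} [Field K] [NumberField K]

noncomputable def stmtLam : stmtX K → ℝ := Function.extend stmtPw (fun q => stmtLg (stmtPi q.1)) 0

lemma stmtLam_pw (q : stmtQ K) : stmtLam (stmtPw q) = stmtLg (stmtPi q.1) :=
  stmtPw_inj.extend_apply _ _ _

lemma stmtLam_zero {I : stmtX K} (h : I ∉ Set.range (stmtPw (K := K))) : stmtLam I = 0 := by
  rw [stmtLam, Function.extend_apply' _ _ _ (by simpa using h)]; rfl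

lemma stmtLam_nonneg (I : stmtX K) : 0 ≤ stmtLam I := by
  by_cases h : I ∈ Set.range (stmtPw (K := K))
  · obtain ⟨q, rfl⟩ := h
    rw [stmtLam_pw]; exact stmtLg_nonneg _
  · rw [stmtLam_zero h]

lemma stmtLg_pw (q : stmtQ K) : stmtLg (stmtPw q) = (q.2 + 1) * stmtLg (stmtPi q.1) := by
  rw [stmtPw, stmtLg_pow]; push_cast; rfl

lemma stmtLam_le (I : stmtX K) : stmtLam I ≤ stmtLg I := by
  by_cases h : I ∈ Set.range (stmtPw (K := K))
  · obtain ⟨q, rfl⟩ := h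
    rw [stmtLam_pw, stmtLg_pw]
    have := stmtLg_nonneg (stmtPi q.1)
    have h2 : (0:ℝ) ≤ q.2 := Nat.cast_nonneg _
    nlinarith
  · rw [stmtLam_zero h]; exact stmtLg_nonneg _

/-- multiplicative weights of norm one -/
structure stmtMul (v : stmtX K → ℂ) : Prop where
  one : v 1 = 1
  mul : ∀ I J, v (I * J) = v I * v J
  norm : ∀ I, ‖v I‖ = 1

lemma stmtCpow_mul (I J : stmtX K) (s : ℂ) : (stmtN (I * J) : ℂ) ^ (-s) = (stmtN I : ℂ) ^ (-s) * (stmtN J : ℂ) ^ (-s) := by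
  rw [stmtN_mul, Nat.cast_mul, Complex.natCast_mul_natCast_cpow]

lemma stmtX_cancel {I J L : stmtX K} (h : I * J = I * L) : J = L := by
  apply Subtype.ext
  exact mul_left_cancel₀ (nonZeroDivisors.coe_ne_zero I) (congrArg Subtype.val h)

lemma stmtG_fiber (I : stmtX K) : HasSum (fun x : ((fun x : stmtQ K × stmtX K => stmtPw x.1 * x.2) ⁻¹' {I}) => stmtLg (stmtPi x.1.1.1)) (stmtLg I) := by
  have hI : HasSum (fun q : {q : stmtQ K | stmtPw q ∣ I} => stmtLg (stmtPi q.1.1)) (stmtLg I) := by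
    have h := stmtQ_log I
    rw [← hasSum_subtype_iff_of_support_subset (s := {q : stmtQ K | stmtPw q ∣ I})] at h
    · refine h.congr_fun fun q => ?_
      have : stmtPw q.1 ∣ I := q.2
      simp [this]
    · intro q hq
      by_contra h
      apply hq
      exact if_neg h
  let E : ((fun x : stmtQ K × stmtX K => stmtPw x.1 * x.2) ⁻¹' {I}) → {q : stmtQ K | stmtPw q ∣ I} :=
    fun x => ⟨x.1.1, ⟨x.1.2, x.2.symm⟩⟩
  have hE : Function.Bijective E := by
    constructor
    · rintro ⟨⟨q, J⟩, hx⟩ ⟨⟨q', J'⟩, hx'⟩ h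
      have h1 : q = q' := congrArg Subtype.val h
      subst h1
      have h2 : J = J' := stmtX_cancel (I := stmtPw q) (Eq.trans hx (Eq.symm hx'))
      subst h2
      rfl
    · rintro ⟨q, J, hJ⟩
      exact ⟨⟨(q, J), hJ.symm⟩, rfl⟩
  exact ((Equiv.ofBijective E hE).hasSum_iff.2 hI)

lemma stmtG_summable_v {v : stmtX K → ℂ} (hv : stmtMul v) (s : ℂ) (hs : 1 < s.re) :
    Summable fun I : stmtX K => v I * (stmtN I : ℂ) ^ (-s) :=
  stmtG_w_summable (fun I => by rw [hv.norm]; linarith [stmtLg_nonneg I, show Real.log (stmtN I) = stmtLg I from rfl]) s hs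

lemma stmtG_summable_Lam {v : stmtX K → ℂ} (hv : stmtMul v) (s : ℂ) (hs : 1 < s.re) :
    Summable fun I : stmtX K => v I * stmtLam I * (stmtN I : ℂ) ^ (-s) := by
  refine stmtG_w_summable (fun I => ?_) s hs
  rw [norm_mul, hv.norm, one_mul, Complex.norm_real, Real.norm_of_nonneg (stmtLam_nonneg I)]
  linarith [stmtLam_le I, show Real.log (stmtN I) = stmtLg I from rfl]

lemma stmtG_hasSum_mul {α β : Type*} {f : α → ℂ} {g : β → ℂ} {a b : ℂ} (hf : HasSum f a) (hg : HasSum g b) :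
    HasSum (fun x : α × β => f x.1 * g x.2) (a * b) := by
  have h := summable_mul_of_summable_norm hf.summable.norm hg.summable.norm
  have := tsum_mul_tsum_of_summable_norm hf.summable.norm hg.summable.norm
  rw [hf.tsum_eq, hg.tsum_eq] at this
  rw [this]
  exact h.hasSum

lemma stmtG_conv {v : stmtX K → ℂ} (hv : stmtMul v) (s : ℂ) (hs : 1 < s.re) :
    HasSum (fun I : stmtX K => v I * stmtLg I * (stmtN I : ℂ) ^ (-s))
      ((∑' I : stmtX K, v I * stmtLam I * (stmtN I : ℂ) ^ (-s)) * ∑' I : stmtX K, v I * (stmtN I : ℂ) ^ (-s)) := by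
  have ha := stmtG_summable_v hv s hs
  have hl := stmtG_summable_Lam hv s hs
  have hz : ∀ I ∉ Set.range (stmtPw (K := K)), v I * stmtLam I * (stmtN I : ℂ) ^ (-s) = 0 := by
    intro I hI; rw [stmtLam_zero hI]; simp
  have hq := (stmtPw_inj.hasSum_iff hz).2 hl.hasSum
  have hp := stmtG_hasSum_mul hq ha.hasSum
  have := hp.tsum_fiberwise (fun x : stmtQ K × stmtX K => stmtPw x.1 * x.2)
  refine this.congr_fun fun I => ?_
  symm
  have hI3 := (Complex.hasSum_ofReal.2 (stmtG_fiber I)).mul_left (v I * (stmtN I : ℂ) ^ (-s))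
  have e : v I * (stmtN I : ℂ) ^ (-s) * ((stmtLg I : ℝ) : ℂ) = v I * stmtLg I * (stmtN I : ℂ) ^ (-s) := by ring
  rw [← e, ← hI3.tsum_eq]
  refine tsum_congr fun x => ?_
  obtain ⟨⟨q, J⟩, hx⟩ := x
  change stmtPw q * J = I at hx
  subst hx
  rw [hv.mul, stmtCpow_mul]
  simp only [Function.comp_apply, stmtLam_pw]
  ring
end stmtG4

section stmtG5
open NumberField Filter Topology IsDedekindDomain
open scoped Classical nonZeroDivisors

variable {K : Type*} [Field K] [NumberField K]

def stmtBd (w : stmtX K → ℂ) : Prop := ∀ I, ‖w I‖ ≤ stmtLg I + 1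

lemma stmtBd.summable {w : stmtX K → ℂ} (hw : stmtBd w) {s : ℂ} (hs : 1 < s.re) :
    Summable fun I : stmtX K => w I * (stmtN I : ℂ) ^ (-s) := stmtG_w_summable hw s hs

lemma stmtBd.hasSum {w : stmtX K → ℂ} (hw : stmtBd w) {s : ℂ} (hs : 1 < s.re) :
    HasSum (fun I : stmtX K => w I * (stmtN I : ℂ) ^ (-s)) (LSeries (stmtA w) s) := by
  rw [(stmtG_LSeries (hw.summable hs)).LSeries_eq]
  exact (hw.summable hs).hasSum

lemma stmtBd.LSummable {w : stmtX K → ℂ} (hw : stmtBd w) {s : ℂ} (hs : 1 < s.re) :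
    LSeriesSummable (stmtA w) s := (stmtG_LSeries (hw.summable hs)).LSeriesSummable

lemma stmtBd.abscissa {w : stmtX K → ℂ} (hw : stmtBd w) : LSeries.abscissaOfAbsConv (stmtA w) ≤ (1 : ℝ) :=
  LSeries.abscissaOfAbsConv_le_of_forall_lt_LSeriesSummable fun y hy => hw.LSummable (by simpa using hy)

lemma stmtBd.abscissa_lt {w : stmtX K → ℂ} (hw : stmtBd w) {s : ℂ} (hs : 1 < s.re) :
    LSeries.abscissaOfAbsConv (stmtA w) < s.re :=
  lt_of_le_of_lt hw.abscissa (by exact_mod_cast hs)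

lemma stmtA_log (w : stmtX K → ℂ) : LSeries.logMul (stmtA w) = stmtA (fun I => w I * stmtLg I) := by
  funext m
  rw [LSeries.logMul, stmtA, stmtA, Finset.mul_sum]
  refine Finset.sum_congr rfl fun I hI => ?_
  rw [stmtLg, stmtFib_mem.1 hI, mul_comm, Complex.natCast_log]

lemma stmtBd.deriv {w : stmtX K → ℂ} (hw : stmtBd w) {s : ℂ} (hs : 1 < s.re) :
    HasDerivAt (LSeries (stmtA w)) (-LSeries (stmtA (fun I => w I * stmtLg I)) s) s := by
  rw [← stmtA_log]
  exact LSeries_hasDerivAt (hw.abscissa_lt hs)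

lemma stmtFib_one : stmtFib (K := K) 1 = {1} := by
  ext I
  rw [stmtFib_mem, Finset.mem_singleton, stmtN, Ideal.absNorm_eq_one_iff]
  constructor
  · intro h
    exact Subtype.ext (by rw [h, ← Ideal.one_eq_top]; rfl)
  · rintro rfl
    exact Ideal.one_eq_top

lemma stmtA_one (w : stmtX K → ℂ) : stmtA w 1 = w 1 := by
  rw [stmtA, stmtFib_one, Finset.sum_singleton]

lemma stmtBd.tendsto {w : stmtX K → ℂ} (hw : stmtBd w) :
    Tendsto (fun x : ℝ => LSeries (stmtA w) x) atTop (𝓝 (w 1)) := by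
  rw [← stmtA_one w]
  exact LSeries.tendsto_atTop (lt_of_le_of_lt hw.abscissa (EReal.coe_lt_top 1))

lemma stmtLam_one : stmtLam (1 : stmtX K) = 0 := by
  have h1 := stmtLam_le (1 : stmtX K)
  have h2 := stmtLam_nonneg (1 : stmtX K)
  have : stmtLg (1 : stmtX K) = 0 := by simp [stmtLg, stmtN]
  linarith

/-- weight of log of the L function -/
noncomputable def stmtLl (I : stmtX K) : ℝ := stmtLam I / stmtLg I

lemma stmtLl_nonneg (I : stmtX K) : 0 ≤ stmtLl I := div_nonneg (stmtLam_nonneg I) (stmtLg_nonneg I)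

lemma stmtLl_le (I : stmtX K) : stmtLl I ≤ 1 := div_le_one_of_le₀ (stmtLam_le I) (stmtLg_nonneg I)

lemma stmtLl_mul (I : stmtX K) : stmtLl I * stmtLg I = stmtLam I := by
  rw [stmtLl]
  rcases (stmtLg_nonneg I).eq_or_lt with h | h
  · have h1 := stmtLam_le I
    have h2 := stmtLam_nonneg I
    rw [← h] at *
    simp; linarith
  · field_simp

lemma stmtMul.bd {v : stmtX K → ℂ} (hv : stmtMul v) : stmtBd v := fun I => by
  rw [hv.norm]; linarith [stmtLg_nonneg I]

lemma stmtMul.bdLam {v : stmtX K → ℂ} (hv : stmtMul v) : stmtBd fun I => v I * stmtLam I := fun I => by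
  rw [norm_mul, hv.norm, one_mul, Complex.norm_real, Real.norm_of_nonneg (stmtLam_nonneg I)]
  linarith [stmtLam_le I]

lemma stmtMul.bdLl {v : stmtX K → ℂ} (hv : stmtMul v) : stmtBd fun I => v I * stmtLl I := fun I => by
  rw [norm_mul, hv.norm, one_mul, Complex.norm_real, Real.norm_of_nonneg (stmtLl_nonneg I)]
  linarith [stmtLl_le I, stmtLg_nonneg I]

lemma stmtMul.bdLg {v : stmtX K → ℂ} (hv : stmtMul v) : stmtBd fun I => v I * stmtLg I := fun I => by
  rw [norm_mul, hv.norm, one_mul, Complex.norm_real, Real.norm_of_nonneg (stmtLg_nonneg I)]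
  linarith

lemma stmtMul.conv {v : stmtX K → ℂ} (hv : stmtMul v) {s : ℂ} (hs : 1 < s.re) :
    LSeries (stmtA fun I => v I * stmtLg I) s = LSeries (stmtA fun I => v I * stmtLam I) s * LSeries (stmtA v) s := by
  rw [← (hv.bd.hasSum hs).tsum_eq, ← (hv.bdLam.hasSum hs).tsum_eq, ← (hv.bdLg.hasSum hs).tsum_eq]
  exact (stmtG_conv hv s hs).tsum_eq

lemma stmtMul.derivL {v : stmtX K → ℂ} (hv : stmtMul v) {s : ℂ} (hs : 1 < s.re) :
    HasDerivAt (LSeries (stmtA v)) (-(LSeries (stmtA fun I => v I * stmtLam I) s * LSeries (stmtA v) s)) s := by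
  rw [← hv.conv hs]
  exact hv.bd.deriv hs

lemma stmtMul.derivG {v : stmtX K → ℂ} (hv : stmtMul v) {s : ℂ} (hs : 1 < s.re) :
    HasDerivAt (LSeries (stmtA fun I => v I * stmtLl I)) (-(LSeries (stmtA fun I => v I * stmtLam I) s)) s := by
  have := hv.bdLl.deriv hs
  have e : (fun I : stmtX K => v I * (stmtLl I : ℂ) * (stmtLg I : ℂ)) = fun I => v I * (stmtLam I : ℂ) := by
    funext I
    rw [mul_assoc, ← Complex.ofReal_mul, stmtLl_mul]
  rwa [e] at this

lemma stmtMul.exp {v : stmtX K → ℂ} (hv : stmtMul v) {s : ℂ} (hs : 1 < s.re) :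
    LSeries (stmtA v) s = Complex.exp (LSeries (stmtA fun I => v I * stmtLl I) s) := by
  let H : ℂ → ℂ := fun s => LSeries (stmtA v) s * Complex.exp (-LSeries (stmtA fun I => v I * stmtLl I) s)
  have hH : ∀ s : ℂ, 1 < s.re → HasDerivAt H 0 s := by
    intro s hs
    have := (hv.derivL hs).mul ((hv.derivG hs).neg.cexp)
    exact this.congr_deriv (by ring)
  have hconst : ∀ x y : ℂ, 1 < x.re → 1 < y.re → H x = H y := by
    intro x y hx hy
    have hc : Convex ℝ {s : ℂ | 1 < s.re} := convex_halfSpace_re_gt 1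
    have ho : IsOpen {s : ℂ | 1 < s.re} := isOpen_lt continuous_const Complex.continuous_re
    refine ho.is_const_of_deriv_eq_zero hc.isPreconnected (fun z hz => (hH z hz).differentiableAt.differentiableWithinAt) (fun z hz => (hH z hz).deriv) hx hy
  have hlim : Tendsto (fun x : ℝ => H x) atTop (𝓝 1) := by
    have h1 := hv.bd.tendsto
    have h2 := hv.bdLl.tendsto
    have h3 := h1.mul ((Complex.continuous_exp.tendsto _).comp h2.neg)
    have e : v 1 * Complex.exp (-(v 1 * (stmtLl (1 : stmtX K) : ℂ))) = 1 := by
      simp [hv.one, stmtLl, stmtLam_one]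
    rw [e] at h3
    exact h3
  have hH1 : H s = 1 := by
    refine tendsto_nhds_unique (tendsto_const_nhds.congr' ?_) hlim
    filter_upwards [eventually_gt_atTop 1] with x hx
    exact hconst _ _ hs (by simpa using hx)
  have : LSeries (stmtA v) s * Complex.exp (-LSeries (stmtA fun I => v I * stmtLl I) s) = 1 := hH1
  rw [Complex.exp_neg] at this
  field_simp [Complex.exp_ne_zero] at this
  exact this
end stmtG5

section stmtG6
open NumberField Filter Topology IsDedekindDomain
open scoped Classical nonZeroDivisors ComplexOrder

def stmtU : Set ℂ := {s : ℂ | -1 < s.re ∧ |s.im| < 3}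

lemma stmtU_open : IsOpen stmtU :=
  (isOpen_lt continuous_const Complex.continuous_re).inter (isOpen_lt (continuous_abs.comp Complex.continuous_im) continuous_const)

lemma stmtU_ball : Metric.ball (2 : ℂ) (5 / 2) ⊆ stmtU := by
  intro s hs
  rw [Metric.mem_ball, Complex.dist_eq] at hs
  have h1 := (Complex.abs_re_le_norm (s - 2)).trans_lt hs
  have h2 := (Complex.abs_im_le_norm (s - 2)).trans_lt hs
  rw [abs_lt] at h1
  simp only [Complex.sub_re, Complex.sub_im, Complex.re_ofNat, Complex.im_ofNat, sub_zero] at h1 h2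
  exact ⟨by linarith [h1.1], by linarith⟩

/-- complete monotonicity argument -/
lemma stmtLandau_aux {H P : ℂ → ℂ} {a : ℕ → ℂ} (ha : 0 ≤ a) (hP : P = LSeries a)
    (hab : LSeries.abscissaOfAbsConv a < (2 : ℝ)) (hH : DifferentiableOn ℂ H stmtU) (h2 : 0 ≤ H 2)
    (hd : ∀ᶠ s in 𝓝 (2 : ℂ), deriv H s = -(P s * H s)) : ‖H 2‖ ≤ ‖H 0‖ := by
  have m2 : (2 : ℂ) ∈ stmtU := stmtU_ball (Metric.mem_ball_self (by norm_num))
  have hHa : AnalyticAt ℂ H 2 := hH.analyticAt (stmtU_open.mem_nhds m2)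
  have hPa : AnalyticAt ℂ P 2 := by
    rw [hP]
    exact LSeries_analyticOnNhd a 2 (by simpa using hab)
  have halt : ∀ n, 0 ≤ (-1) ^ n * iteratedDeriv n H 2 := by
    intro n
    induction n using Nat.strong_induction_on with
    | _ n ih =>
      rcases n with _ | n
      · simpa using h2
      · rw [iteratedDeriv_succ']
        have e1 : deriv H =ᶠ[𝓝 2] -(P * H) := hd
        rw [e1.iteratedDeriv_eq, iteratedDeriv_neg, iteratedDeriv_mul (hPa.contDiffAt) (hHa.contDiffAt)]
        have e2 : (-1) ^ (n + 1) * -(∑ i ∈ Finset.range (n + 1), (n.choose i) * iteratedDeriv i P 2 * iteratedDeriv (n - i) H 2)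
          = ∑ i ∈ Finset.range (n + 1), (n.choose i : ℂ) * (((-1) ^ i * iteratedDeriv i P 2) * ((-1) ^ (n - i) * iteratedDeriv (n - i) H 2)) := by
          rw [pow_succ, mul_neg, mul_neg_one, neg_mul, neg_neg, Finset.mul_sum]
          refine Finset.sum_congr rfl fun i hi => ?_
          have hi' : i + (n - i) = n := by
            have := Finset.mem_range.1 hi
            omega
          have : ((-1 : ℂ)) ^ n = (-1) ^ i * (-1) ^ (n - i) := by rw [← pow_add, hi']
          rw [this]; ring
        rw [e2]
        refine Finset.sum_nonneg fun i hi => ?_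
        refine mul_nonneg (by positivity) (mul_nonneg ?_ (ih _ (by omega)))
        rw [hP]
        have := LSeries.iteratedDeriv_alternating ha hab i
        simpa using this
  have hf : DifferentiableOn ℂ (fun w => H (-w) - H 2) (Metric.ball (-2) (5 / 2)) := by
    refine DifferentiableOn.sub_const ?_ _
    refine (hH.mono stmtU_ball).comp differentiable_neg.differentiableOn ?_
    intro w hw
    rw [Metric.mem_ball] at hw ⊢
    rw [← dist_neg_neg, neg_neg]; exact hw
  have h' : ∀ n, 0 ≤ iteratedDeriv n (fun w => H (-w) - H 2) (-2) := by
    intro n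
    cases n with
    | zero => simp
    | succ n =>
      have h := halt (n + 1)
      have e : iteratedDeriv (n + 1) (fun w => H (-w) - H 2) (-2) = iteratedDeriv (n + 1) (fun w => H (-w)) (-2) := by
        rw [iteratedDeriv_succ', iteratedDeriv_succ']
        rw [funext fun x ↦ deriv_sub_const (f := fun w => H (-w)) (x := x) (H 2)]
      rw [e, iteratedDeriv_comp_neg, neg_neg, smul_eq_mul]
      exact h
  have hz : (-2 : ℂ) ≤ 0 := by
    rw [Complex.le_def]; simp
  have := hf.nonneg_of_iteratedDeriv_nonneg h' hz (by simp; norm_num)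
  simp only [neg_zero, sub_nonneg] at this
  rw [← Complex.re_eq_norm.2 h2]
  exact (Complex.le_def.1 this).1.trans (Complex.re_le_norm _)

variable {K : Type*} [Field K] [NumberField K]

lemma stmtA_nonneg {b : stmtX K → ℝ} (hb : ∀ I, 0 ≤ b I) : 0 ≤ stmtA (fun I => (b I : ℂ)) := by
  intro m
  exact Finset.sum_nonneg fun I _ => Complex.zero_le_real.2 (hb I)

lemma stmtLandau {b : stmtX K → ℝ} (hb : ∀ I, 0 ≤ b I) (hb1 : ∀ I, b I ≤ 1) {h : ℝ} (hh : 0 ≤ h)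
    {F : ℂ → ℂ} (hF : DifferentiableOn ℂ F stmtU)
    (hFe : ∀ s : ℂ, 1 < s.re → |s.im| < 3 → F s = Complex.exp (h * LSeries (stmtA fun I => (b I : ℂ)) s))
    (S : Finset (stmtX K)) : Real.exp (h * ∑ I ∈ S, b I) ≤ ‖F 0‖ := by
  let b2 : stmtX K → ℝ := fun I => if I ∈ S then 0 else b I
  have hb2 : ∀ I, 0 ≤ b2 I := fun I => by
    simp only [b2]; split_ifs
    · exact le_rfl
    · exact hb I
  have hb21 : ∀ I, b2 I ≤ 1 := fun I => by
    simp only [b2]; split_ifs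
    · exact zero_le_one
    · exact hb1 I
  have bd : stmtBd fun I : stmtX K => (b I : ℂ) := fun I => by
    rw [Complex.norm_real, Real.norm_of_nonneg (hb I)]; linarith [hb1 I, stmtLg_nonneg I]
  have bd2 : stmtBd fun I : stmtX K => (b2 I : ℂ) := fun I => by
    rw [Complex.norm_real, Real.norm_of_nonneg (hb2 I)]; linarith [hb21 I, stmtLg_nonneg I]
  have hbl : ∀ I, 0 ≤ b2 I * stmtLg I := fun I => mul_nonneg (hb2 I) (stmtLg_nonneg I)
  have bdl : stmtBd fun I : stmtX K => ((b2 I * stmtLg I : ℝ) : ℂ) := fun I => by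
    rw [Complex.norm_real, Real.norm_of_nonneg (hbl I)]
    nlinarith [hb21 I, stmtLg_nonneg I]
  let G1 : ℂ → ℂ := fun s => ∑ I ∈ S, (b I : ℂ) * (stmtN I : ℂ) ^ (-s)
  have hG1 : Differentiable ℂ G1 := by
    refine Differentiable.fun_sum fun I _ => ?_
    refine Differentiable.const_mul ?_ _
    intro s
    refine DifferentiableAt.const_cpow differentiableAt_id.neg (Or.inl ?_)
    exact_mod_cast (stmtN_pos I).ne'
  have hsplit : ∀ s : ℂ, 1 < s.re → LSeries (stmtA fun I => (b I : ℂ)) s = G1 s + LSeries (stmtA fun I => (b2 I : ℂ)) s := by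
    intro s hs
    have h1 := bd2.hasSum hs
    have h2 : HasSum (fun I : stmtX K => if I ∈ S then (b I : ℂ) * (stmtN I : ℂ) ^ (-s) else 0) (G1 s) := by
      have : G1 s = ∑ I ∈ S, (if I ∈ S then (b I : ℂ) * (stmtN I : ℂ) ^ (-s) else 0) :=
        Finset.sum_congr rfl fun I hI => by rw [if_pos hI]
      rw [this]
      exact hasSum_sum_of_ne_finset_zero fun I hI => if_neg hI
    refine (bd.hasSum hs).unique ((h2.add h1).congr_fun fun I => ?_)
    simp only [b2]
    split_ifs <;> simp
  let H : ℂ → ℂ := fun s => F s * Complex.exp (-(h * G1 s))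
  have hH : DifferentiableOn ℂ H stmtU := hF.mul (((hG1.const_mul _).neg.cexp).differentiableOn)
  have hHe : ∀ s : ℂ, 1 < s.re → |s.im| < 3 → H s = Complex.exp (h * LSeries (stmtA fun I => (b2 I : ℂ)) s) := by
    intro s hs hs'
    simp only [H]
    rw [hFe s hs hs', hsplit s hs, ← Complex.exp_add]
    congr 1; ring
  have hab2 : LSeries.abscissaOfAbsConv (stmtA fun I => (b2 I : ℂ)) < (2 : ℝ) :=
    lt_of_le_of_lt bd2.abscissa (by exact_mod_cast one_lt_two)
  have hpos : 0 ≤ LSeries (stmtA fun I => (b2 I : ℂ)) 2 := by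
    have := LSeries.iteratedDeriv_alternating (stmtA_nonneg hb2) hab2 0
    simpa using this
  obtain ⟨r, hr0, hr⟩ : ∃ r : ℝ, 0 ≤ r ∧ LSeries (stmtA fun I => (b2 I : ℂ)) 2 = r :=
    ⟨_, (Complex.nonneg_iff.1 hpos).1, (Complex.ext rfl (by simpa using (Complex.nonneg_iff.1 hpos).2.symm))⟩
  have hH2 : H 2 = (Real.exp (h * r) : ℝ) := by
    rw [hHe 2 (by simp) (by simp), hr]; push_cast; rfl
  have key := stmtLandau_aux (H := H) (P := LSeries ((h : ℂ) • stmtA fun I => ((b2 I * stmtLg I : ℝ) : ℂ)))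
    (a := (h : ℂ) • stmtA fun I => ((b2 I * stmtLg I : ℝ) : ℂ)) (by
      have h1 := stmtA_nonneg hbl
      intro m
      exact mul_nonneg (Complex.zero_le_real.2 hh) (h1 m)) rfl (by
      refine lt_of_le_of_lt (LSeries.abscissaOfAbsConv_le_of_forall_lt_LSeriesSummable (x := 1) fun y hy => ?_) (by exact_mod_cast one_lt_two)
      exact (bdl.LSummable (by simpa using hy)).smul _) hH (by
      rw [hH2]; exact_mod_cast (Real.exp_pos _).le) (by
      have hV : IsOpen {s : ℂ | 1 < s.re ∧ |s.im| < 3} :=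
        (isOpen_lt continuous_const Complex.continuous_re).inter (isOpen_lt (continuous_abs.comp Complex.continuous_im) continuous_const)
      have m2 : (2 : ℂ) ∈ {s : ℂ | 1 < s.re ∧ |s.im| < 3} := ⟨by simp, by simp⟩
      filter_upwards [hV.mem_nhds m2] with s hs
      have e : H =ᶠ[𝓝 s] fun s => Complex.exp (h * LSeries (stmtA fun I => (b2 I : ℂ)) s) := by
        filter_upwards [hV.mem_nhds hs] with z hz
        exact hHe z hz.1 hz.2
      rw [e.deriv_eq, (((bd2.deriv hs.1).const_mul (h : ℂ)).cexp).deriv, hHe s hs.1 hs.2, LSeries_smul]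
      push_cast
      ring)
  rw [hH2, Complex.norm_real, Real.norm_of_nonneg (Real.exp_pos _).le] at key
  have h0 : H 0 = F 0 * (Real.exp (-(h * ∑ I ∈ S, b I)) : ℝ) := by
    simp only [H, G1]
    push_cast
    simp
  rw [h0, norm_mul, Complex.norm_real, Real.norm_of_nonneg (Real.exp_pos _).le, Real.exp_neg] at key
  have h1 : 1 ≤ Real.exp (h * r) := Real.one_le_exp (mul_nonneg hh hr0)
  have h2 : 1 ≤ ‖F 0‖ * (Real.exp (h * ∑ I ∈ S, b I))⁻¹ := h1.trans key
  rwa [← div_eq_mul_inv, one_le_div (Real.exp_pos _)] at h2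
end stmtG6

section stmtG7
open NumberField Filter Topology IsDedekindDomain
open scoped Classical nonZeroDivisors ComplexOrder

abbrev stmtCh (K : Type*) [Field K] [NumberField K] := AddChar (Additive (ClassGroup (𝓞 K))) ℂ

variable {K : Type*} [Field K] [NumberField K]

noncomputable def stmtV (ψ : stmtCh K) (I : stmtX K) : ℂ := ψ (Additive.ofMul (ClassGroup.mk0 I))

lemma stmtV_mul (ψ : stmtCh K) : stmtMul (stmtV ψ) where
  one := by simp [stmtV]
  mul I J := by simp [stmtV, AddChar.map_add_eq_mul]
  norm I := by simp [stmtV]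

lemma stmtV_A (ψ : stmtCh K) (m : ℕ) : stmtA (stmtV ψ) m =
    (∑ c : ClassGroup (𝓞 K), ψ (Additive.ofMul c) • (fun n => (stmtCnt c n : ℂ))) m := by
  simp only [Finset.sum_apply, Pi.smul_apply, smul_eq_mul, ← stmtG_cnt_A, stmtA, Finset.mul_sum]
  rw [Finset.sum_comm]
  refine Finset.sum_congr rfl fun I _ => ?_
  simp [stmtV]

noncomputable def stmtH (K : Type*) [Field K] [NumberField K] : ℕ := Fintype.card (ClassGroup (𝓞 K))

lemma stmtH_pos : 0 < stmtH K := Fintype.card_pos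

lemma stmtV_Z (ψ : stmtCh K) : ∃ Z : ℂ → ℂ, DifferentiableOn ℂ Z stmtU ∧
    (∀ s : ℂ, 1 < s.re → |s.im| < 3 → Z s = (s - 1) * LSeries (stmtA (stmtV ψ)) s) ∧
    Z 1 = if ψ = 0 then (stmtKappa K * stmtH K : ℂ) else 0 := by
  choose Z hZ hZ1 hZ2 using stmtG_Z (K := K)
  refine ⟨fun s => ∑ c, ψ (Additive.ofMul c) * Z c s, ?_, ?_, ?_⟩
  · exact DifferentiableOn.fun_sum fun c _ => (hZ c).const_mul _
  · intro s hs hs'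
    have e : stmtA (stmtV ψ) = ∑ c : ClassGroup (𝓞 K), ψ (Additive.ofMul c) • (fun n => (stmtCnt c n : ℂ)) :=
      funext (stmtV_A ψ)
    rw [e, LSeries_sum (fun c _ => (stmtG_cnt_summable c s hs).smul _), Finset.mul_sum]
    refine Finset.sum_congr rfl fun c _ => ?_
    rw [hZ1 c s hs hs', LSeries_smul]; ring
  · simp only [hZ2]
    rw [← Finset.sum_mul]
    have := AddChar.sum_eq_ite ψ
    have e : ∑ c : ClassGroup (𝓞 K), ψ (Additive.ofMul c) = ∑ a : Additive (ClassGroup (𝓞 K)), ψ a :=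
      Fintype.sum_equiv Additive.ofMul _ _ fun c => rfl
    rw [e, this]
    split_ifs
    · rw [mul_comm, stmtH, Fintype.card_additive]
    · simp

lemma stmtU_one : (1 : ℂ) ∈ stmtU := by constructor <;> simp

lemma stmt_dslope {Z L : ℂ → ℂ} (hZ : DifferentiableOn ℂ Z stmtU)
    (hL : ∀ s : ℂ, 1 < s.re → |s.im| < 3 → Z s = (s - 1) * L s) (h1 : Z 1 = 0) :
    DifferentiableOn ℂ (dslope Z 1) stmtU ∧ ∀ s : ℂ, 1 < s.re → |s.im| < 3 → dslope Z 1 s = L s := by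
  refine ⟨(Complex.differentiableOn_dslope (stmtU_open.mem_nhds stmtU_one)).2 hZ, fun s hs hs' => ?_⟩
  have hne : s ≠ 1 := by
    rintro rfl
    simp at hs
  rw [dslope_of_ne _ hne, slope_def_field, h1, sub_zero, hL s hs hs']
  field_simp [sub_ne_zero.2 hne]

lemma stmtV_ext {ψ : stmtCh K} (hψ : ψ ≠ 0) : ∃ M : ℂ → ℂ, DifferentiableOn ℂ M stmtU ∧
    ∀ s : ℂ, 1 < s.re → |s.im| < 3 → M s = LSeries (stmtA (stmtV ψ)) s := by
  obtain ⟨Z, h1, h2, h3⟩ := stmtV_Z ψ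
  rw [if_neg hψ] at h3
  exact ⟨_, stmt_dslope h1 h2 h3⟩

/-- weight of principal prime powers -/
noncomputable def stmtB (I : stmtX K) : ℝ := if ClassGroup.mk0 I = 1 then stmtLl I else 0

lemma stmtB_nonneg (I : stmtX K) : 0 ≤ stmtB I := by
  unfold stmtB
  split_ifs
  · exact stmtLl_nonneg I
  · exact le_rfl

lemma stmtB_le (I : stmtX K) : stmtB I ≤ 1 := by
  unfold stmtB
  split_ifs
  · exact stmtLl_le I
  · exact zero_le_one

lemma stmtB_sum (I : stmtX K) : ∑ ψ : stmtCh K, stmtV ψ I * (stmtLl I : ℂ) = stmtH K * stmtB I := by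
  rw [← Finset.sum_mul]
  simp only [stmtV, stmtB]
  rw [AddChar.sum_apply_eq_ite]
  by_cases h : ClassGroup.mk0 I = 1
  · rw [if_pos h, h]
    simp [stmtH]
  · rw [if_neg h, if_neg (by simpa using h)]; simp

lemma stmtProd {s : ℂ} (hs : 1 < s.re) : ∏ ψ : stmtCh K, LSeries (stmtA (stmtV ψ)) s =
    Complex.exp ((stmtH K : ℝ) * LSeries (stmtA fun I : stmtX K => (stmtB I : ℂ)) s) := by
  rw [Finset.prod_congr rfl fun ψ _ => (stmtV_mul ψ).exp hs, ← Complex.exp_sum]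
  congr 1
  have bd : stmtBd fun I : stmtX K => (stmtB I : ℂ) := fun I => by
    rw [Complex.norm_real, Real.norm_of_nonneg (stmtB_nonneg I)]; linarith [stmtB_le I, stmtLg_nonneg I]
  have h1 := (bd.hasSum hs).mul_left ((stmtH K : ℝ) : ℂ)
  have h2 : HasSum (fun I : stmtX K => ∑ ψ : stmtCh K, (stmtV ψ I * (stmtLl I : ℂ)) * (stmtN I : ℂ) ^ (-s))
      (∑ ψ : stmtCh K, LSeries (stmtA fun I : stmtX K => stmtV ψ I * (stmtLl I : ℂ)) s) :=
    hasSum_sum fun ψ _ => (stmtV_mul ψ).bdLl.hasSum hs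
  refine h2.unique (h1.congr_fun fun I => ?_)
  rw [← Finset.sum_mul, stmtB_sum]
  push_cast; ring

lemma stmtP_nonempty : Nonempty (stmtP K) := by
  obtain ⟨M, hM⟩ := Ideal.exists_maximal (𝓞 K)
  have : M ≠ ⊥ := Ring.ne_bot_of_isMaximal_of_not_isField hM (RingOfIntegers.not_isField K)
  exact ⟨⟨M, hM.isPrime, this⟩⟩

lemma stmtB_not_summable : ¬ Summable (stmtB (K := K)) := by
  intro hs
  obtain ⟨p⟩ := stmtP_nonempty (K := K)
  have hh := stmtH_pos (K := K)
  let e : ℕ → stmtQ K := fun k => (p, stmtH K * (k + 1) - 1)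
  have hee : ∀ k, stmtH K * (k + 1) - 1 + 1 = stmtH K * (k + 1) := fun k => Nat.sub_add_cancel (by nlinarith)
  have he : Function.Injective e := by
    intro k l h
    have h1 : stmtH K * (k + 1) - 1 = stmtH K * (l + 1) - 1 := congrArg Prod.snd h
    have h2 : stmtH K * (k + 1) = stmtH K * (l + 1) := by rw [← hee, ← hee l, h1]
    have := Nat.eq_of_mul_eq_mul_left hh h2
    omega
  have h1 := hs.comp_injective (stmtPw_inj.comp he)
  have h2 : ∀ k, (stmtB ∘ (stmtPw ∘ e)) k = (1 / (stmtH K : ℝ)) * (1 / ((k : ℝ) + 1)) := by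
    intro k
    have hc : ClassGroup.mk0 (stmtPw (e k)) = 1 := by
      rw [stmtPw]
      simp only [e, hee]
      rw [map_pow, pow_mul, stmtH, pow_card_eq_one, one_pow]
    simp only [Function.comp_apply, stmtB]
    rw [if_pos hc, stmtLl, stmtLam_pw, stmtLg_pw]
    have hp := stmtLg_Pi_pos p
    have : (((e k).2 : ℝ) + 1) = stmtH K * (k + 1) := by
      have := hee k
      exact_mod_cast this
    rw [this]
    have hh' : (0:ℝ) < stmtH K := by exact_mod_cast hh
    have e1 : stmtLg (stmtPi (e k).1) = stmtLg (stmtPi p) := rfl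
    rw [e1]
    field_simp
  have h3 : Summable fun k : ℕ => (1 / ((k : ℝ) + 1)) := by
    have := (h1.congr h2).mul_left (stmtH K : ℝ)
    refine this.congr fun k => ?_
    have hh' : (0:ℝ) < stmtH K := by exact_mod_cast hh
    field_simp
  have h4 : Summable fun k : ℕ => (1 / (k : ℝ)) := by
    rw [← summable_nat_add_iff 1]
    simpa using h3
  exact Real.not_summable_one_div_natCast h4

/-- nonvanishing -/
lemma stmtNonvan {ψ : stmtCh K} (hψ : ψ ≠ 0) {M : ℂ → ℂ} (hM : DifferentiableOn ℂ M stmtU)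
    (hMe : ∀ s : ℂ, 1 < s.re → |s.im| < 3 → M s = LSeries (stmtA (stmtV ψ)) s) : M 1 ≠ 0 := by
  intro h0
  obtain ⟨Z, hZ, hZe, -⟩ := stmtV_Z (0 : stmtCh K)
  have hex : ∀ φ : stmtCh K, ∃ M : ℂ → ℂ, φ ≠ 0 → DifferentiableOn ℂ M stmtU ∧
    ∀ s : ℂ, 1 < s.re → |s.im| < 3 → M s = LSeries (stmtA (stmtV φ)) s := by
    intro φ
    by_cases h : φ = 0
    · exact ⟨0, fun h' => absurd h h'⟩
    · obtain ⟨M, h1, h2⟩ := stmtV_ext h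
      exact ⟨M, fun _ => ⟨h1, h2⟩⟩
  choose Ms hMs using hex
  let T : Finset (stmtCh K) := (Finset.univ.erase 0).erase ψ
  let F : ℂ → ℂ := fun s => Z s * dslope M 1 s * ∏ φ ∈ T, Ms φ s
  have hT : ∀ φ ∈ T, φ ≠ 0 := fun φ hφ => Finset.ne_of_mem_erase (Finset.mem_of_mem_erase hφ)
  have hF : DifferentiableOn ℂ F stmtU := by
    refine (hZ.mul ((Complex.differentiableOn_dslope (stmtU_open.mem_nhds stmtU_one)).2 hM)).mul ?_
    exact DifferentiableOn.fun_finsetProd fun φ hφ => (hMs φ (hT φ hφ)).1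
  have hFe : ∀ s : ℂ, 1 < s.re → |s.im| < 3 → F s = Complex.exp ((stmtH K : ℝ) * LSeries (stmtA fun I : stmtX K => (stmtB I : ℂ)) s) := by
    intro s hs hs'
    have hne : s - 1 ≠ 0 := by
      rw [sub_ne_zero]
      rintro rfl
      simp at hs
    rw [← stmtProd hs, ← Finset.mul_prod_erase Finset.univ _ (Finset.mem_univ (0 : stmtCh K)),
      ← Finset.mul_prod_erase _ _ (Finset.mem_erase.2 ⟨hψ, Finset.mem_univ ψ⟩), ← hMe s hs hs',
      ← Finset.prod_congr rfl fun φ hφ => (hMs φ (hT φ hφ)).2 s hs hs', ← mul_assoc]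
    simp only [F]
    congr 1
    rw [hZe s hs hs', dslope_of_ne _ (sub_ne_zero.1 hne), slope_def_field, h0, sub_zero]
    field_simp
  have hbound := stmtLandau stmtB_nonneg stmtB_le (Nat.cast_nonneg (stmtH K)) hF hFe
  apply stmtB_not_summable (K := K)
  have hh' : (1:ℝ) ≤ stmtH K := by exact_mod_cast stmtH_pos (K := K)
  refine summable_of_sum_le stmtB_nonneg (c := ‖F 0‖) fun S => ?_
  have h1 := hbound S
  have h2 := Real.add_one_le_exp ((stmtH K : ℝ) * ∑ I ∈ S, stmtB I)
  have h3 : 0 ≤ ∑ I ∈ S, stmtB I := Finset.sum_nonneg fun I _ => stmtB_nonneg I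
  nlinarith
end stmtG7

section stmtG8
open NumberField Filter Topology IsDedekindDomain
open scoped Classical nonZeroDivisors

variable {K : Type*} [Field K] [NumberField K]

lemma stmtV_open : IsOpen {s : ℂ | 1 < s.re ∧ |s.im| < 3} :=
  (isOpen_lt continuous_const Complex.continuous_re).inter (isOpen_lt (continuous_abs.comp Complex.continuous_im) continuous_const)

lemma stmt_toOne : Tendsto (fun s : ℝ => (s : ℂ)) (𝓝[>] 1) (𝓝 1) := by
  have := (Complex.continuous_ofReal.tendsto 1).mono_left (nhdsWithin_le_nhds (s := Set.Ioi 1))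
  simpa using this

lemma stmt_logderiv {A : ℂ → ℂ} (hA : DifferentiableOn ℂ A stmtU) (h1 : A 1 ≠ 0) :
    Tendsto (fun s : ℝ => ((s : ℂ) - 1) * (deriv A s / A s)) (𝓝[>] 1) (𝓝 0) := by
  have ha : AnalyticAt ℂ A 1 := hA.analyticAt (stmtU_open.mem_nhds stmtU_one)
  have h2 := ((ha.deriv.continuousAt.div ha.continuousAt h1).tendsto.comp stmt_toOne)
  have h3 := (stmt_toOne.sub_const 1).mul h2
  simpa using h3

lemma stmtP_tendsto (ψ : stmtCh K) : Tendsto (fun s : ℝ => ((s : ℂ) - 1) * LSeries (stmtA fun I => stmtV ψ I * (stmtLam I : ℂ)) s)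
    (𝓝[>] 1) (𝓝 (if ψ = 0 then 1 else 0)) := by
  have hv := stmtV_mul ψ
  have hLne : ∀ s : ℂ, 1 < s.re → LSeries (stmtA (stmtV ψ)) s ≠ 0 := fun s hs => by
    rw [hv.exp hs]; exact Complex.exp_ne_zero _
  by_cases hψ : ψ = 0
  · rw [if_pos hψ]
    obtain ⟨Z, hZ, hZe, hZ1⟩ := stmtV_Z ψ
    rw [if_pos hψ] at hZ1
    have hZ1' : Z 1 ≠ 0 := by
      rw [hZ1]
      refine mul_ne_zero ?_ ?_
      · exact_mod_cast (stmtKappa_pos (K := K)).ne'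
      · exact_mod_cast (stmtH_pos (K := K)).ne'
    have := (stmt_logderiv hZ hZ1').const_sub 1
    rw [sub_zero] at this
    refine this.congr' ?_
    filter_upwards [self_mem_nhdsWithin] with s hs
    have hs1 : 1 < (s : ℂ).re := by simpa using hs
    have hs2 : |(s : ℂ).im| < 3 := by simp
    have e : Z =ᶠ[𝓝 (s : ℂ)] fun z => (z - 1) * LSeries (stmtA (stmtV ψ)) z := by
      filter_upwards [stmtV_open.mem_nhds ⟨hs1, hs2⟩] with z hz
      exact hZe z hz.1 hz.2
    have hd := ((hasDerivAt_id (s : ℂ)).sub_const 1).mul (hv.derivL hs1)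
    have hd2 : deriv Z s = _ := e.deriv_eq.trans hd.deriv
    rw [hd2, hZe s hs1 hs2]
    have hne : (s : ℂ) - 1 ≠ 0 := by
      rw [sub_ne_zero]
      intro h
      rw [h] at hs1
      simp at hs1
    have := hLne s hs1
    simp only [id]
    field_simp
    ring
  · rw [if_neg hψ]
    obtain ⟨M, hM, hMe⟩ := stmtV_ext hψ
    have hM1 := stmtNonvan hψ hM hMe
    have := (stmt_logderiv hM hM1).neg
    rw [neg_zero] at this
    refine this.congr' ?_
    filter_upwards [self_mem_nhdsWithin] with s hs
    have hs1 : 1 < (s : ℂ).re := by simpa using hs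
    have hs2 : |(s : ℂ).im| < 3 := by simp
    have e : M =ᶠ[𝓝 (s : ℂ)] LSeries (stmtA (stmtV ψ)) := by
      filter_upwards [stmtV_open.mem_nhds ⟨hs1, hs2⟩] with z hz
      exact hMe z hz.1 hz.2
    have hd2 : deriv M s = _ := e.deriv_eq.trans (hv.derivL hs1).deriv
    rw [hd2, hMe s hs1 hs2]
    have := hLne s hs1
    field_simp

noncomputable def stmtLc (c : ClassGroup (𝓞 K)) (I : stmtX K) : ℝ := if ClassGroup.mk0 I = c then stmtLam I else 0

lemma stmtLc_nonneg (c : ClassGroup (𝓞 K)) (I : stmtX K) : 0 ≤ stmtLc c I := by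
  unfold stmtLc
  split_ifs
  · exact stmtLam_nonneg I
  · exact le_rfl

lemma stmtLc_le (c : ClassGroup (𝓞 K)) (I : stmtX K) : stmtLc c I ≤ stmtLg I := by
  unfold stmtLc
  split_ifs
  · exact stmtLam_le I
  · exact stmtLg_nonneg I

lemma stmtLc_bd (c : ClassGroup (𝓞 K)) : stmtBd fun I => (stmtLc c I : ℂ) := fun I => by
  rw [Complex.norm_real, Real.norm_of_nonneg (stmtLc_nonneg c I)]; linarith [stmtLc_le c I]

lemma stmtLc_sum (c : ClassGroup (𝓞 K)) (I : stmtX K) :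
    ∑ ψ : stmtCh K, ψ (-Additive.ofMul c) * (stmtV ψ I * (stmtLam I : ℂ)) = stmtH K * stmtLc c I := by
  simp only [← mul_assoc, stmtV, ← AddChar.map_add_eq_mul]
  rw [← Finset.sum_mul, AddChar.sum_apply_eq_ite]
  unfold stmtLc
  by_cases h : ClassGroup.mk0 I = c
  · rw [if_pos h, h]
    simp [stmtH]
  · rw [if_neg h, if_neg]
    · simp
    · rw [neg_add_eq_zero]
      intro h'
      exact h (Additive.ofMul.injective h').symm

lemma stmtLc_tendstoC (c : ClassGroup (𝓞 K)) : Tendsto (fun s : ℝ => ((s : ℂ) - 1) * LSeries (stmtA fun I => (stmtLc c I : ℂ)) s)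
    (𝓝[>] 1) (𝓝 (1 / stmtH K)) := by
  have h1 : Tendsto (fun s : ℝ => ∑ ψ : stmtCh K, ψ (-Additive.ofMul c) * (((s : ℂ) - 1) * LSeries (stmtA fun I => stmtV ψ I * (stmtLam I : ℂ)) s))
    (𝓝[>] 1) (𝓝 (∑ ψ : stmtCh K, ψ (-Additive.ofMul c) * (if ψ = 0 then 1 else 0))) :=
    tendsto_finsetSum _ fun ψ _ => (stmtP_tendsto ψ).const_mul _
  have e1 : (∑ ψ : stmtCh K, ψ (-Additive.ofMul c) * (if ψ = 0 then (1:ℂ) else 0)) = 1 := by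
    simp
  rw [e1] at h1
  have hh : (stmtH K : ℂ) ≠ 0 := by exact_mod_cast (stmtH_pos (K := K)).ne'
  have h2 := h1.const_mul (1 / (stmtH K : ℂ))
  rw [mul_one] at h2
  refine h2.congr' ?_
  filter_upwards [self_mem_nhdsWithin] with s hs
  have hs1 : 1 < (s : ℂ).re := by simpa using hs
  have h3 : HasSum (fun I : stmtX K => ∑ ψ : stmtCh K, ψ (-Additive.ofMul c) * ((stmtV ψ I * (stmtLam I : ℂ)) * (stmtN I : ℂ) ^ (-(s:ℂ))))
      (∑ ψ : stmtCh K, ψ (-Additive.ofMul c) * LSeries (stmtA fun I : stmtX K => stmtV ψ I * (stmtLam I : ℂ)) s) :=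
    hasSum_sum fun ψ _ => ((stmtV_mul ψ).bdLam.hasSum hs1).mul_left _
  have h4 := ((stmtLc_bd c).hasSum hs1).mul_left (stmtH K : ℂ)
  have h5 := h3.unique (h4.congr_fun fun I => by
    simp only [← mul_assoc _ _ ((stmtN I : ℂ) ^ (-(s:ℂ)))]
    rw [← Finset.sum_mul, stmtLc_sum])
  have h6 : ∑ ψ : stmtCh K, ψ (-Additive.ofMul c) * (((s : ℂ) - 1) * LSeries (stmtA fun I => stmtV ψ I * (stmtLam I : ℂ)) s)
    = ((s : ℂ) - 1) * ∑ ψ : stmtCh K, ψ (-Additive.ofMul c) * LSeries (stmtA fun I : stmtX K => stmtV ψ I * (stmtLam I : ℂ)) s := by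
    rw [Finset.mul_sum]
    exact Finset.sum_congr rfl fun ψ _ => by ring
  rw [h6, h5]
  field_simp

lemma stmtLc_hasSum (c : ClassGroup (𝓞 K)) {s : ℝ} (hs : 1 < s) :
    HasSum (fun I : stmtX K => stmtLc c I * (stmtN I : ℝ) ^ (-s)) (LSeries (stmtA fun I => (stmtLc c I : ℂ)) s).re := by
  have h1 := (stmtLc_bd c).hasSum (s := (s : ℂ)) (by simpa using hs)
  refine (Complex.hasSum_re h1).congr_fun fun I => ?_
  rw [← Complex.ofReal_natCast, ← Complex.ofReal_neg, ← Complex.ofReal_cpow (Nat.cast_nonneg _), ← Complex.ofReal_mul, Complex.ofReal_re]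

lemma stmtLc_tendsto (c : ClassGroup (𝓞 K)) : Tendsto (fun s : ℝ => (s - 1) * ∑' I : stmtX K, stmtLc c I * (stmtN I : ℝ) ^ (-s))
    (𝓝[>] 1) (𝓝 (1 / stmtH K)) := by
  have h1 := (Complex.continuous_re.tendsto _).comp (stmtLc_tendstoC c)
  have e : (1 / (stmtH K : ℂ)).re = 1 / (stmtH K : ℝ) := by
    rw [← Complex.ofReal_natCast, ← Complex.ofReal_one, ← Complex.ofReal_div, Complex.ofReal_re]
  rw [e] at h1
  refine h1.congr' ?_
  filter_upwards [self_mem_nhdsWithin] with s hs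
  rw [(stmtLc_hasSum c hs).tsum_eq, Function.comp_apply, ← Complex.ofReal_one, ← Complex.ofReal_sub, Complex.re_ofReal_mul]

noncomputable def stmtPc (c : ClassGroup (𝓞 K)) (p : stmtP K) : ℝ := if ClassGroup.mk0 (stmtPi p) = c then stmtLg (stmtPi p) else 0

lemma stmtPc_nonneg (c : ClassGroup (𝓞 K)) (p : stmtP K) : 0 ≤ stmtPc c p := by
  unfold stmtPc
  split_ifs
  · exact stmtLg_nonneg _
  · exact le_rfl

lemma stmtPc_eq (c : ClassGroup (𝓞 K)) (p : stmtP K) : stmtPc c p = stmtLc c (stmtPw (p, 0)) := by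
  have h := stmtLam_pw (p, 0)
  rw [stmtPc, stmtLc, h]
  simp [stmtPw]

lemma stmtPi_inj : Function.Injective (stmtPi (K := K)) := by
  intro p q h
  exact HeightOneSpectrum.ext (congrArg Subtype.val h)

lemma stmtPc_summable (c : ClassGroup (𝓞 K)) {s : ℝ} (hs : 1 < s) :
    Summable fun p : stmtP K => stmtPc c p * (stmtN (stmtPi p) : ℝ) ^ (-s) := by
  have h := ((stmtLc_hasSum c hs).summable.comp_injective stmtPw_inj).comp_injective
    (show Function.Injective (fun p : stmtP K => ((p, 0) : stmtQ K)) from fun p q h => congrArg Prod.fst h)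
  refine h.congr fun p => ?_
  simp only [Function.comp_apply, ← stmtPc_eq]
  simp [stmtPw]

lemma stmtPc_bound (c : ClassGroup (𝓞 K)) : ∃ B : ℝ, ∀ s : ℝ, 1 < s →
    ∑' p : stmtP K, stmtPc c p * (stmtN (stmtPi p) : ℝ) ^ (-s) ≤ ∑' I : stmtX K, stmtLc c I * (stmtN I : ℝ) ^ (-s) ∧
    ∑' I : stmtX K, stmtLc c I * (stmtN I : ℝ) ^ (-s) ≤ (∑' p : stmtP K, stmtPc c p * (stmtN (stmtPi p) : ℝ) ^ (-s)) + B := by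
  have hs2 : Summable fun p : stmtP K => stmtLg (stmtPi p) * (stmtN (stmtPi p) : ℝ) ^ (-2 : ℝ) := by
    have h := stmtG_w_summable (K := K) (w := fun I => (stmtLg I : ℂ)) (fun I => by
      rw [Complex.norm_real, Real.norm_of_nonneg (stmtLg_nonneg I)]; linarith [show Real.log (stmtN I) = stmtLg I from rfl]) 2 (by simp)
    have h2 := h.norm.comp_injective stmtPi_inj
    refine h2.congr fun p => ?_
    simp only [Function.comp_apply]
    rw [norm_mul, Complex.norm_natCast_cpow_of_pos (stmtN_pos _), Complex.norm_real, Real.norm_of_nonneg (stmtLg_nonneg _)]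
    simp
  have hgeo : Summable fun k : ℕ => (2:ℝ) * (1/2) ^ k := summable_geometric_two.mul_left 2
  have hprod : Summable fun q : stmtQ K => (stmtLg (stmtPi q.1) * (stmtN (stmtPi q.1) : ℝ) ^ (-2 : ℝ)) * ((2:ℝ) * (1/2) ^ q.2) :=
    hs2.mul_of_nonneg hgeo (fun p => mul_nonneg (stmtLg_nonneg _) (by positivity)) (fun k => by positivity)
  refine ⟨∑' q : stmtQ K, (stmtLg (stmtPi q.1) * (stmtN (stmtPi q.1) : ℝ) ^ (-2 : ℝ)) * ((2:ℝ) * (1/2) ^ q.2), fun s hs => ?_⟩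
  have hX := stmtLc_hasSum c hs
  have hQ : HasSum (fun q : stmtQ K => stmtLc c (stmtPw q) * (stmtN (stmtPw q) : ℝ) ^ (-s)) (∑' I : stmtX K, stmtLc c I * (stmtN I : ℝ) ^ (-s)) := by
    refine (stmtPw_inj.hasSum_iff ?_).2 hX.summable.hasSum
    intro I hI
    simp [stmtLc, stmtLam_zero hI]
  let g : stmtQ K → ℝ := fun q => stmtLc c (stmtPw q) * (stmtN (stmtPw q) : ℝ) ^ (-s)
  have hg0 : ∀ q, 0 ≤ g q := fun q => mul_nonneg (stmtLc_nonneg _ _) (by positivity)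
  have hP : HasSum (fun q : stmtQ K => if q.2 = 0 then g q else 0) (∑' p : stmtP K, stmtPc c p * (stmtN (stmtPi p) : ℝ) ^ (-s)) := by
    have hinj : Function.Injective (fun p : stmtP K => ((p, 0) : stmtQ K)) := fun p q h => congrArg Prod.fst h
    refine (hinj.hasSum_iff ?_).1 ((stmtPc_summable c hs).hasSum.congr_fun fun p => ?_)
    · rintro ⟨p, k⟩ h
      rw [if_neg]
      rintro rfl
      exact h ⟨p, rfl⟩
    · simp only [Function.comp_apply, if_true, g, ← stmtPc_eq]
      simp [stmtPw]
  have hle : ∀ q : stmtQ K, g q ≤ (if q.2 = 0 then g q else 0) + (stmtLg (stmtPi q.1) * (stmtN (stmtPi q.1) : ℝ) ^ (-2 : ℝ)) * ((2:ℝ) * (1/2) ^ q.2) := by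
    rintro ⟨p, k⟩
    have hNp : (2:ℝ) ≤ stmtN (stmtPi p) := by exact_mod_cast stmtPi_two_le p
    have hlg := stmtLg_nonneg (stmtPi p)
    rcases k with _ | k
    · simp only [if_true]
      have : 0 ≤ (stmtLg (stmtPi p) * (stmtN (stmtPi p) : ℝ) ^ (-2 : ℝ)) * ((2:ℝ) * (1/2) ^ 0) := by positivity
      linarith
    · simp only [Nat.succ_ne_zero, if_false, zero_add, g]
      have h1 : stmtLc c (stmtPw (p, k + 1)) ≤ stmtLg (stmtPi p) := by
        rw [stmtLc, stmtLam_pw]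
        split_ifs
        · exact le_rfl
        · exact hlg
      have h2 : (stmtN (stmtPw (p, k + 1)) : ℝ) ^ (-s) ≤ (stmtN (stmtPi p) : ℝ) ^ (-2 : ℝ) * ((2:ℝ) * (1/2) ^ (k+1)) := by
        have e1 : (stmtN (stmtPw (p, k + 1)) : ℝ) = (stmtN (stmtPi p) : ℝ) ^ (k + 2) := by
          rw [stmtPw, stmtN_pow]; push_cast; rfl
        have h3 : (stmtN (stmtPw (p, k + 1)) : ℝ) ^ (-s) ≤ (stmtN (stmtPw (p, k + 1)) : ℝ) ^ (-1 : ℝ) :=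
          Real.rpow_le_rpow_of_exponent_le (stmtN_one_le _) (by linarith)
        refine h3.trans ?_
        rw [e1, Real.rpow_neg_one, Real.rpow_neg (by linarith), Real.rpow_ofNat, pow_add, mul_inv, mul_comm]
        refine mul_le_mul_of_nonneg_left ?_ (by positivity)
        rw [pow_succ, show (2:ℝ) * ((1/2) ^ k * (1/2)) = (1/2) ^ k by ring, one_div, inv_pow]
        gcongr
      calc _ ≤ stmtLg (stmtPi p) * ((stmtN (stmtPi p) : ℝ) ^ (-2 : ℝ) * ((2:ℝ) * (1/2) ^ (k+1))) := by
            gcongr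
        _ = _ := by ring
  constructor
  · refine hasSum_le (fun q => ?_) hP hQ
    split_ifs
    · exact le_rfl
    · exact hg0 q
  · exact hasSum_le hle hQ (hP.add hprod.hasSum)

lemma stmtPc_tendsto (c : ClassGroup (𝓞 K)) : Tendsto (fun s : ℝ => (s - 1) * ∑' p : stmtP K, stmtPc c p * (stmtN (stmtPi p) : ℝ) ^ (-s))
    (𝓝[>] 1) (𝓝 (1 / stmtH K)) := by
  obtain ⟨B, hB⟩ := stmtPc_bound c
  have h1 := stmtLc_tendsto c
  have h2 : Tendsto (fun s : ℝ => (s - 1) * B) (𝓝[>] 1) (𝓝 0) := by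
    have : Tendsto (fun s : ℝ => (s - 1) * B) (𝓝 1) (𝓝 ((1 - 1) * B)) := ((continuous_id.sub continuous_const).mul continuous_const).tendsto 1
    rw [sub_self, zero_mul] at this
    exact this.mono_left nhdsWithin_le_nhds
  have h3 := h1.sub h2
  rw [sub_zero] at h3
  refine tendsto_of_tendsto_of_tendsto_of_le_of_le' h3 h1 ?_ ?_
  · filter_upwards [self_mem_nhdsWithin] with s hs
    have hs1 : 0 < s - 1 := sub_pos.2 hs
    have := (hB s hs).2
    nlinarith
  · filter_upwards [self_mem_nhdsWithin] with s hs
    have hs1 : 0 < s - 1 := sub_pos.2 hs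
    exact mul_le_mul_of_nonneg_left (hB s hs).1 hs1.le
end stmtG8

section stmtG9
open NumberField Filter Topology IsDedekindDomain
open scoped Classical nonZeroDivisors

variable {K : Type*} [Field K] [NumberField K]

lemma stmtFin_bounds (c : ClassGroup (𝓞 K)) : ∃ σ0 : ℝ, 0 < σ0 ∧ ∀ σ : ℝ, 0 < σ → σ < σ0 →
    1 / 2 * (1 / (stmtH K : ℝ)) ≤ σ * ∑' p : stmtP K, stmtPc c p * (stmtN (stmtPi p) : ℝ) ^ (-(1 + σ)) ∧
    σ * ∑' p : stmtP K, stmtPc c p * (stmtN (stmtPi p) : ℝ) ^ (-(1 + σ)) ≤ 2 * (1 / (stmtH K : ℝ)) := by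
  have hh : (0:ℝ) < 1 / (stmtH K : ℝ) := one_div_pos.2 (by exact_mod_cast stmtH_pos)
  have h := (stmtPc_tendsto c).eventually (Ioo_mem_nhds (a := 1 / 2 * (1 / (stmtH K : ℝ))) (b := 2 * (1 / (stmtH K : ℝ)))
    (by linarith) (by linarith))
  rw [eventually_iff, mem_nhdsGT_iff_exists_Ioo_subset] at h
  obtain ⟨u, hu, h⟩ := h
  refine ⟨u - 1, sub_pos.2 hu, fun σ h1 h2 => ?_⟩
  have h3 := h (show (1 + σ) ∈ Set.Ioo 1 u from ⟨by linarith, by linarith⟩)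
  have h4 : (1 + σ - 1) * ∑' p : stmtP K, stmtPc c p * (stmtN (stmtPi p) : ℝ) ^ (-(1 + σ)) ∈ Set.Ioo (1 / 2 * (1 / (stmtH K : ℝ))) (2 * (1 / (stmtH K : ℝ))) := h3
  rw [add_sub_cancel_left] at h4
  exact ⟨h4.1.le, h4.2.le⟩

lemma stmtFin_key (c : ClassGroup (𝓞 K)) {δ : ℝ} (hδ : 0 < δ) : ∃ B : ℝ, ∀ (M : stmtX K) (L : ℝ),
    (∀ p : stmtP K, ClassGroup.mk0 (stmtPi p) = c → stmtLg (stmtPi p) ≤ L → stmtPi p ∣ M) →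
    L ≤ B + δ * stmtLg M := by
  obtain ⟨σ0, hσ0, hb⟩ := stmtFin_bounds c
  have hh : (0:ℝ) < (stmtH K : ℝ) := by exact_mod_cast stmtH_pos
  set h : ℝ := (stmtH K : ℝ) with hhdef
  let Y : ℝ := 120 * h / δ
  have hY : 0 < Y := by positivity
  have hfin : {p : stmtP K | (stmtN (stmtPi p) : ℝ) ≤ Y}.Finite := by
    refine ((stmtN_finite (K := K) ⌊Y⌋₊).preimage (stmtPi_inj.injOn)).subset ?_
    intro p hp
    exact Nat.le_floor hp
  let BY : ℝ := ∑' p : stmtP K, (if (stmtN (stmtPi p) : ℝ) ≤ Y then stmtPc c p else 0)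
  have hBs : Summable fun p : stmtP K => (if (stmtN (stmtPi p) : ℝ) ≤ Y then stmtPc c p else 0) := by
    refine summable_of_hasFiniteSupport (hfin.subset ?_)
    intro p hp
    by_contra hn
    exact hp (if_neg hn)
  have hBY : 0 ≤ BY := tsum_nonneg fun p => by
    split_ifs
    · exact stmtPc_nonneg _ _
    · exact le_rfl
  refine ⟨120 * h * BY + (30 / σ0 + 1), fun M L hL => ?_⟩
  have hM := stmtLg_nonneg M
  have hq : 0 < 30 / σ0 := by positivity
  by_cases hLs : L ≤ 30 / σ0 + 1
  · have : 0 ≤ 120 * h * BY := by positivity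
    nlinarith
  push Not at hLs
  have hL0 : 0 < L := by linarith
  let σ : ℝ := 30 / L
  have hσ : 0 < σ := by positivity
  have hσL : σ * L = 30 := div_mul_cancel₀ _ hL0.ne'
  have hσs : σ < σ0 := by
    rw [div_lt_iff₀ hL0]
    have : 30 / σ0 < L := by linarith
    rw [div_lt_iff₀ hσ0] at this
    linarith
  have b1 := (hb σ hσ hσs).1
  have b2 := (hb (σ/2) (by positivity) (by linarith)).2
  have s1 := stmtPc_summable c (show 1 < 1 + σ by linarith)
  have s2 := stmtPc_summable c (show 1 < 1 + σ/2 by linarith)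
  set F1 := ∑' p : stmtP K, stmtPc c p * (stmtN (stmtPi p) : ℝ) ^ (-(1 + σ))
  set F2 := ∑' p : stmtP K, stmtPc c p * (stmtN (stmtPi p) : ℝ) ^ (-(1 + σ/2))
  have hle : ∀ p : stmtP K, stmtPc c p * (stmtN (stmtPi p) : ℝ) ^ (-(1 + σ)) ≤
      Real.exp (-15) * (stmtPc c p * (stmtN (stmtPi p) : ℝ) ^ (-(1 + σ/2))) +
      (if (stmtN (stmtPi p) : ℝ) ≤ Y then stmtPc c p else 0) + (stmtCt p M * stmtLg (stmtPi p)) * Y⁻¹ := by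
    intro p
    have hpc := stmtPc_nonneg c p
    have hlg := stmtLg_nonneg (stmtPi p)
    have hN1 := stmtN_one_le (stmtPi p)
    have hN0 : (0:ℝ) < stmtN (stmtPi p) := by linarith
    have t1 : 0 ≤ Real.exp (-15) * (stmtPc c p * (stmtN (stmtPi p) : ℝ) ^ (-(1 + σ/2))) := by positivity
    have t2 : 0 ≤ (if (stmtN (stmtPi p) : ℝ) ≤ Y then stmtPc c p else 0) := by
      split_ifs
      · exact hpc
      · exact le_rfl
    have t3 : 0 ≤ (stmtCt p M * stmtLg (stmtPi p)) * Y⁻¹ := by positivity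
    by_cases hc : ClassGroup.mk0 (stmtPi p) = c
    · by_cases hl : stmtLg (stmtPi p) ≤ L
      · have hd := hL p hc hl
        have hct : 1 ≤ stmtCt p M := (stmtCt_iff p M 1).2 (by rwa [pow_one])
        by_cases hy : (stmtN (stmtPi p) : ℝ) ≤ Y
        · rw [if_pos hy]
          have : (stmtN (stmtPi p) : ℝ) ^ (-(1 + σ)) ≤ 1 := Real.rpow_le_one_of_one_le_of_nonpos hN1 (by linarith)
          have := mul_le_of_le_one_right hpc this
          linarith
        · have e : stmtPc c p = stmtLg (stmtPi p) := if_pos hc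
          push Not at hy
          have h1 : (stmtN (stmtPi p) : ℝ) ^ (-(1 + σ)) ≤ Y⁻¹ := by
            calc _ ≤ (stmtN (stmtPi p) : ℝ) ^ (-1 : ℝ) := Real.rpow_le_rpow_of_exponent_le hN1 (by linarith)
              _ = (stmtN (stmtPi p) : ℝ)⁻¹ := Real.rpow_neg_one _
              _ ≤ Y⁻¹ := by gcongr
          have h2 : stmtPc c p * (stmtN (stmtPi p) : ℝ) ^ (-(1 + σ)) ≤ (stmtCt p M * stmtLg (stmtPi p)) * Y⁻¹ := by
            rw [e]
            refine mul_le_mul ?_ h1 (by positivity) (by positivity)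
            have : (1:ℝ) ≤ stmtCt p M := by exact_mod_cast hct
            nlinarith
          linarith
      · push Not at hl
        have h1 : (stmtN (stmtPi p) : ℝ) ^ (-(1 + σ)) ≤ Real.exp (-15) * (stmtN (stmtPi p) : ℝ) ^ (-(1 + σ/2)) := by
          rw [show -(1 + σ) = -(σ/2) + -(1 + σ/2) by ring, Real.rpow_add hN0]
          refine mul_le_mul_of_nonneg_right ?_ (by positivity)
          rw [Real.rpow_def_of_pos hN0]
          apply Real.exp_le_exp.2
          have : L < Real.log (stmtN (stmtPi p)) := hl
          nlinarith
        have := mul_le_mul_of_nonneg_left h1 hpc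
        linarith
    · have e : stmtPc c p = 0 := if_neg hc
      rw [e, zero_mul]
      rw [e] at t1 t2
      linarith
  have hsum := hasSum_le hle s1.hasSum (((s2.hasSum.mul_left (Real.exp (-15))).add hBs.hasSum).add ((stmtP_log M).mul_right Y⁻¹))
  change F1 ≤ Real.exp (-15) * F2 + BY + stmtLg M * Y⁻¹ at hsum
  have hexp : Real.exp (-15) ≤ 1 / 16 := by
    rw [Real.exp_neg, one_div]
    have := Real.add_one_le_exp (15:ℝ)
    gcongr
    linarith
  have hF2 : 0 ≤ F2 := tsum_nonneg fun p => mul_nonneg (stmtPc_nonneg _ _) (by positivity)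
  have hF : F1 ≤ 1 / 16 * F2 + BY + stmtLg M * Y⁻¹ := by nlinarith
  have k1 : 1/2 * (1 / h) * L ≤ 30 * F1 := by
    calc _ ≤ (σ * F1) * L := by gcongr
      _ = (σ * L) * F1 := by ring
      _ = _ := by rw [hσL]
  have k2 : 15 * F2 ≤ 2 * (1 / h) * L := by
    calc _ = (σ * L) / 2 * F2 := by rw [hσL]; ring
      _ = (σ / 2 * F2) * L := by ring
      _ ≤ _ := by gcongr
  have k3 : 1 / 4 * (1 / h) * L ≤ 30 * (BY + stmtLg M * Y⁻¹) := by linarith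
  have k4 : L ≤ 120 * h * (BY + stmtLg M * Y⁻¹) := by
    calc L = 4 * h * (1 / 4 * (1 / h) * L) := by field_simp
      _ ≤ 4 * h * (30 * (BY + stmtLg M * Y⁻¹)) := by gcongr
      _ = _ := by ring
  have k5 : 120 * h * (stmtLg M * Y⁻¹) = δ * stmtLg M := by
    simp only [Y]; field_simp
  linarith

end stmtG9

section stmtG10
open NumberField
lemma stmtFin_exists (K : Type*) [Field K] [NumberField K] (ε : ℝ) (hε : 0 < ε) :
    ∃ C : ℝ, 0 < C ∧ ∀ 𝔟 : Ideal (𝓞 K), 𝔟 ≠ ⊥ → ∃ p : stmtP K, ¬ p.asIdeal ∣ 𝔟 ∧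
      ¬ p.asIdeal ∣ differentIdeal ℤ (𝓞 K) ∧ Submodule.IsPrincipal (𝔟 * p.asIdeal) ∧
      (Ideal.absNorm p.asIdeal : ℝ) ≤ C * (Ideal.absNorm 𝔟 : ℝ) ^ ε := by
  have hD : differentIdeal ℤ (𝓞 K) ≠ ⊥ := differentIdeal_ne_bot
  let D : stmtX K := ⟨differentIdeal ℤ (𝓞 K), mem_nonZeroDivisors_of_ne_zero hD⟩
  choose B hB using fun c : ClassGroup (𝓞 K) => stmtFin_key c hε
  let B0 : ℝ := ∑ c, |B c|
  have hB0 : ∀ c, B c ≤ B0 := fun c =>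
    (le_abs_self _).trans (Finset.single_le_sum (f := fun c => |B c|) (fun i _ => abs_nonneg _) (Finset.mem_univ c))
  refine ⟨Real.exp (B0 + 1 + ε * stmtLg D), Real.exp_pos _, fun 𝔟 h𝔟 => ?_⟩
  let b : stmtX K := ⟨𝔟, mem_nonZeroDivisors_of_ne_zero h𝔟⟩
  have hbpos : (0:ℝ) < (Ideal.absNorm 𝔟 : ℝ) := by exact_mod_cast stmtN_pos b
  let c := (ClassGroup.mk0 b)⁻¹
  let L : ℝ := B0 + 1 + ε * stmtLg (b * D)
  have hex : ∃ p : stmtP K, ClassGroup.mk0 (stmtPi p) = c ∧ stmtLg (stmtPi p) ≤ L ∧ ¬ stmtPi p ∣ b * D := by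
    by_contra hn
    push Not at hn
    have := hB c (b * D) L hn
    have := hB0 c
    simp only [L] at *
    linarith
  obtain ⟨p, hpc, hpL, hpd⟩ := hex
  have hnd : ∀ I : stmtX K, p.asIdeal ∣ (I : Ideal (𝓞 K)) → stmtPi p ∣ I := by
    intro I hI
    have := (stmtCt_iff p I 1).1
    obtain ⟨J, hJ⟩ := hI
    have hJ0 : J ≠ 0 := by
      rintro rfl
      exact nonZeroDivisors.coe_ne_zero I (by rw [hJ, mul_zero])
    exact ⟨⟨J, mem_nonZeroDivisors_of_ne_zero hJ0⟩, Subtype.ext hJ⟩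
  have hpb : ¬ p.asIdeal ∣ 𝔟 := fun h => hpd ((hnd b h).mul_right D)
  have hpD : ¬ p.asIdeal ∣ differentIdeal ℤ (𝓞 K) := fun h => hpd ((hnd D h).mul_left b)
  have hprin : Submodule.IsPrincipal (𝔟 * p.asIdeal) := by
    have h1 : ClassGroup.mk0 (b * stmtPi p) = 1 := by
      rw [map_mul, hpc]; exact mul_inv_cancel _
    exact (ClassGroup.mk0_eq_one_iff (b * stmtPi p).2).1 h1
  have hNp : (Ideal.absNorm p.asIdeal : ℝ) ≤ Real.exp (B0 + 1 + ε * stmtLg D) * (Ideal.absNorm 𝔟 : ℝ) ^ ε := by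
    have h1 : (Ideal.absNorm p.asIdeal : ℝ) = Real.exp (stmtLg (stmtPi p)) :=
      (Real.exp_log (by exact_mod_cast stmtN_pos (stmtPi p))).symm
    rw [h1, Real.rpow_def_of_pos hbpos, ← Real.exp_add]
    apply Real.exp_le_exp.2
    refine hpL.trans (le_of_eq ?_)
    simp only [L, stmtLg_mul]
    have : stmtLg b = Real.log (Ideal.absNorm 𝔟 : ℝ) := rfl
    rw [this]; ring
  exact ⟨p, hpb, hpD, hprin, hNp⟩

end stmtG10
open NumberField

/-- For every `ε > 0` there is a constant `C > 0` such that for every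
nonzero integral ideal `𝔟` of the ring of integers of a number field `K`, one can find
`α ∈ 𝔟` and an unramified prime ideal `𝔭` coprime to `𝔟` with `N𝔭 ≤ C (N𝔟)^ε` and
`(α) = 𝔟𝔭`; in particular `|N_{K/ℚ}(α)| ≤ C (N𝔟)^{1+ε}`. (Unramified is expressed as
`𝔭` not dividing the different ideal.) -/
theorem stmt12 (K : Type*) [Field K] [NumberField K] (ε : ℝ) (hε : 0 < ε) :
    ∃ C : ℝ, 0 < C ∧ ∀ 𝔟 : Ideal (𝓞 K), 𝔟 ≠ ⊥ →
      ∃ (α : 𝓞 K) (𝔭 : Ideal (𝓞 K)), α ∈ 𝔟 ∧ 𝔭.IsPrime ∧ 𝔭 ≠ ⊥ ∧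
        IsCoprime 𝔭 𝔟 ∧
        ¬ 𝔭 ∣ differentIdeal ℤ (𝓞 K) ∧
        (Ideal.absNorm 𝔭 : ℝ) ≤ C * (Ideal.absNorm 𝔟 : ℝ) ^ ε ∧
        Ideal.span {α} = 𝔟 * 𝔭 ∧
        |(Algebra.norm ℚ (α : K))| ≤ C * (Ideal.absNorm 𝔟 : ℝ) ^ (1 + ε) := by
  obtain ⟨C, hC, H⟩ := stmtFin_exists K ε hε
  refine ⟨C, hC, fun 𝔟 h𝔟 => ?_⟩
  obtain ⟨p, hpb, hpD, hprin, hNp⟩ := H 𝔟 h𝔟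
  have hbpos : (0:ℝ) < (Ideal.absNorm 𝔟 : ℝ) := by
    exact_mod_cast Nat.pos_of_ne_zero (fun h => h𝔟 (Ideal.absNorm_eq_zero_iff.1 h))
  obtain ⟨α, hα⟩ := hprin.principal
  have hα' : Ideal.span {α} = 𝔟 * p.asIdeal := hα.symm
  have hpp : p.asIdeal.IsPrime := p.isPrime
  have hpm : p.asIdeal.IsMaximal := p.isMaximal
  have hp0 : p.asIdeal ≠ ⊥ := p.ne_bot
  refine ⟨α, p.asIdeal, ?_, hpp, hp0, ?_, hpD, hNp, hα', ?_⟩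
  · have : α ∈ 𝔟 * p.asIdeal := by rw [← hα']; exact Ideal.mem_span_singleton_self α
    exact (Ideal.mul_le_left (I := 𝔟) (J := p.asIdeal)) this
  · rw [Ideal.isCoprime_iff_sup_eq]
    refine hpm.1.2 _ (lt_of_le_of_ne le_sup_left fun h => hpb ?_)
    rw [Ideal.dvd_iff_le, h]
    exact le_sup_right
  · have h1 : ((|Algebra.norm ℚ (α : K)| : ℚ) : ℝ) = (Ideal.absNorm 𝔟 : ℝ) * (Ideal.absNorm p.asIdeal : ℝ) := by
      rw [← Nat.cast_mul, ← map_mul, ← hα', Ideal.absNorm_span_singleton, ← Algebra.coe_norm_int]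
      push_cast
      rw [Nat.cast_natAbs]
      push_cast
      rfl
    push_cast at h1 ⊢
    rw [h1, Real.rpow_add hbpos, Real.rpow_one]
    calc _ ≤ (Ideal.absNorm 𝔟 : ℝ) * (C * (Ideal.absNorm 𝔟 : ℝ) ^ ε) := by gcongr
      _ = _ := by ring
end

section
/- Let K be a number field with Dedekind zeta function ζ_K(s) = Σ_𝔞 (N𝔞)^{-s}, converging for Re(s) > 1. Let Δ_K denote the residue of ζ_K at s = 1. Then the number of nonzero integral ideals 𝔞 of 𝔬_K with N𝔞 ≤ X equals Δ_K·X + o(X) as X → ∞. -/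
open NumberField Filter

theorem aux_fiber (K : Type*) [Field K] [NumberField K] (s : ℝ) (n : ℕ) :
    HasSum (fun x : {x : {I : Ideal (𝓞 K) // I ≠ ⊥} // Ideal.absNorm x.1 = n} =>
      (Ideal.absNorm x.1.1 : ℝ) ^ (-s))
      (if n = 0 then 0 else (Nat.card {I : Ideal (𝓞 K) // Ideal.absNorm I = n} : ℝ) / (n : ℝ) ^ s) := by
  have hfin : Finite {I : Ideal (𝓞 K) // Ideal.absNorm I = n} :=
    Ideal.finite_setOfPred_absNorm_eq n
  have hfun : (fun x : {x : {I : Ideal (𝓞 K) // I ≠ ⊥} // Ideal.absNorm x.1 = n} =>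
      (Ideal.absNorm x.1.1 : ℝ) ^ (-s)) = fun _ => (n : ℝ) ^ (-s) := by
    funext x; rw [x.2]
  rw [hfun]
  split_ifs with h
  · subst h
    have : IsEmpty {x : {I : Ideal (𝓞 K) // I ≠ ⊥} // Ideal.absNorm x.1 = 0} :=
      ⟨fun x => x.1.2 (Ideal.absNorm_eq_zero_iff.1 x.2)⟩
    exact hasSum_empty
  · let e : {x : {I : Ideal (𝓞 K) // I ≠ ⊥} // Ideal.absNorm x.1 = n} ≃
        {I : Ideal (𝓞 K) // Ideal.absNorm I = n} :=
      { toFun := fun x => ⟨x.1.1, x.2⟩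
        invFun := fun x => ⟨⟨x.1, fun hb => h (by rw [← x.2, hb, Ideal.absNorm_bot])⟩, x.2⟩
        left_inv := fun x => rfl
        right_inv := fun x => rfl }
    have := Fintype.ofFinite {I : Ideal (𝓞 K) // Ideal.absNorm I = n}
    have := Fintype.ofEquiv _ e.symm
    convert! hasSum_fintype (fun _ : {x : {I : Ideal (𝓞 K) // I ≠ ⊥} //
      Ideal.absNorm x.1 = n} => (n : ℝ) ^ (-s)) using 1
    rw [← Nat.card_congr e, Finset.sum_const, Finset.card_univ, Nat.card_eq_fintype_card,
      nsmul_eq_mul, Real.rpow_neg (Nat.cast_nonneg _), div_eq_mul_inv]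

theorem aux_zeta (K : Type*) [Field K] [NumberField K] (s : ℝ) :
    dedekindZeta K s =
      ((∑' 𝔞 : {I : Ideal (𝓞 K) // I ≠ ⊥}, (Ideal.absNorm (𝔞 : Ideal (𝓞 K)) : ℝ) ^ (-s) : ℝ) : ℂ) := by
  have hL : dedekindZeta K s = ((∑' n : ℕ, (if n = 0 then 0 else
      (Nat.card {I : Ideal (𝓞 K) // Ideal.absNorm I = n} : ℝ) / (n : ℝ) ^ s) : ℝ) : ℂ) := by
    rw [dedekindZeta, LSeries, Complex.ofReal_tsum]
    refine tsum_congr fun n => ?_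
    rw [LSeries.term_def]
    split_ifs with h
    · simp
    · push_cast
      rw [Complex.ofReal_cpow (Nat.cast_nonneg _)]
      simp
  rw [hL]
  congr 1
  let e := Equiv.sigmaFiberEquiv (fun x : {I : Ideal (𝓞 K) // I ≠ ⊥} => Ideal.absNorm x.1)
  let f : {I : Ideal (𝓞 K) // I ≠ ⊥} → ℝ := fun x => (Ideal.absNorm x.1 : ℝ) ^ (-s)
  have hf : ∀ x, 0 ≤ (f ∘ e) x := fun x => Real.rpow_nonneg (Nat.cast_nonneg _) _
  have hfib : ∀ n, ∑' c, (f ∘ e) ⟨n, c⟩ = (if n = 0 then 0 else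
      (Nat.card {I : Ideal (𝓞 K) // Ideal.absNorm I = n} : ℝ) / (n : ℝ) ^ s) :=
    fun n => (aux_fiber K s n).tsum_eq
  change _ = ∑' x, f x
  rw [← e.tsum_eq f]
  change _ = ∑' x, (f ∘ e) x
  simp_rw [← hfib]
  by_cases hs : Summable (f ∘ e)
  · exact hs.tsum_sigma.symm
  · rw [tsum_eq_zero_of_not_summable hs, tsum_eq_zero_of_not_summable]
    intro h
    exact hs ((summable_sigma_of_nonneg hf).2 ⟨fun n => (aux_fiber K s n).summable, h⟩)

/-- Let `Δ_K` be the residue at `s = 1` of the Dedekind zeta function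
`ζ_K(s) = Σ_𝔞 (N𝔞)^{-s}` (characterised here as the limit of `(s−1)ζ_K(s)` as `s → 1⁺`
along the real axis). Then the number of nonzero integral ideals of norm at most `X`
equals `Δ_K X + o(X)` as `X → ∞`, i.e. the counting function divided by `X` tends
to `Δ_K`. -/
theorem stmt18 (K : Type*) [Field K] [NumberField K] (ΔK : ℝ)
    (hΔ : Tendsto (fun s : ℝ => (s - 1) *
        ∑' 𝔞 : {I : Ideal (𝓞 K) // I ≠ ⊥}, (Ideal.absNorm (𝔞 : Ideal (𝓞 K)) : ℝ) ^ (-s))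
      (nhdsWithin 1 (Set.Ioi 1)) (nhds ΔK)) :
    Tendsto (fun X : ℝ =>
        (Nat.card {𝔞 : Ideal (𝓞 K) // 𝔞 ≠ ⊥ ∧ (Ideal.absNorm 𝔞 : ℝ) ≤ X} : ℝ) / X)
      atTop (nhds ΔK) := by
  have h1 := tendsto_sub_one_mul_dedekindZeta_nhdsGT K
  have h2 := (Complex.continuous_ofReal.tendsto ΔK).comp hΔ
  have h3 : dedekindZeta_residue K = ΔK := by
    refine Complex.ofReal_injective (tendsto_nhds_unique h1 (h2.congr fun s => ?_))
    simp only [Function.comp_apply]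
    rw [aux_zeta]
    push_cast
    rfl
  rw [← h3]
  refine (NumberField.Ideal.tendsto_norm_le_div_atTop₀ K).congr fun X => ?_
  congr 2
  refine Nat.card_congr ((Equiv.subtypeSubtypeEquivSubtypeInter
    (fun I : Ideal (𝓞 K) => I ∈ nonZeroDivisors (Ideal (𝓞 K)))
    (fun I => (Ideal.absNorm I : ℝ) ≤ X)).trans (Equiv.subtypeEquivRight fun I => ?_))
  rw [mem_nonZeroDivisors_iff_ne_zero]
  rfl
end
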